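/- Let (Σ, loc) form a tree-of-bags architecture with bags B_1,…,B_ℓ, and let A be a DFA with n states over Σ satisfying the diamond property with respect to I_loc. Suppose there is an integer k ≥ 1 such that for every bag B and every trace t ∈ L_t(A), every factor of length at least k of every linearisation of t|_{Σ^in(B)} involves all processes of B. Then there exists a finite asynchronous automaton B over (Σ, loc) with L_t(B) = L_t(A) such that every outer process has at most 2k · n^3 · (2|Σ| + 1)^{3k} local states and every inner process has at most 2k · n · (2|Σ| + 1)^{3k} local states. -/

import Mathlib

variable {α P : Type*}

/-- One swap of two adjacent independent letters. -/
def SwapAdj [DecidableEq P] (loc : α → Finset P) (w w' : List α) : Prop :=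
  ∃ (u v : List α) (a b : α), loc a ∩ loc b = ∅ ∧
    w = u ++ a :: b :: v ∧ w' = u ++ b :: a :: v

/-- Trace equivalence: finitely many swaps of adjacent independent letters. -/
def TraceEquiv [DecidableEq P] (loc : α → Finset P) : List α → List α → Prop :=
  Relation.ReflTransGen (SwapAdj loc)

/-- The set of processes participating in a word. -/
def locWord [DecidableEq P] (loc : α → Finset P) (w : List α) : Finset P :=
  w.foldr (fun a s => loc a ∪ s) ∅

/-- Deterministic finite-state automaton with partial transition function. -/
structure DetAut (α Q : Type*) where
  init : Q
  step : Q → α → Option Q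
  final : Set Q

/-- Extended (partial) transition function on words. -/
def DetAut.run {Q : Type*} (A : DetAut α Q) (q : Q) (w : List α) : Option Q :=
  w.foldlM A.step q

/-- The word language accepted by the DFA. -/
def DetAut.lang {Q : Type*} (A : DetAut α Q) : Set (List α) :=
  {w | ∃ qf ∈ A.final, A.run A.init w = some qf}

/-- The diamond property of a DFA with respect to the independence relation. -/
def DetAut.Diamond {Q : Type*} [DecidableEq P] (loc : α → Finset P)
    (A : DetAut α Q) : Prop :=
  ∀ a b q q' q'', loc a ∩ loc b = ∅ →
    A.step q a = some q' → A.step q' b = some q'' →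
    ∃ q''', A.step q b = some q''' ∧ A.step q''' a = some q''

/-- Asynchronous automaton over a distributed alphabet `(α, loc)`: the
transition for letter `a` only reads and writes the components of processes
in `loc a`. -/
structure AsyncAut (α : Type*) {P : Type*} (loc : α → Finset P) (Q : P → Type*) where
  init : ∀ p, Q p
  trans : α → (∀ p, Q p) → (∀ p, Q p)
  final : Set (∀ p, Q p)
  trans_untouched : ∀ a s p, p ∉ loc a → trans a s p = s p
  trans_local : ∀ a s s', (∀ p ∈ loc a, s p = s' p) →
    ∀ p ∈ loc a, trans a s p = trans a s' p

/-- The global state reached from the initial state when reading `w`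
in the semantics of the asynchronous automaton. -/
def AsyncAut.run {loc : α → Finset P} {Q : P → Type*}
    (B : AsyncAut α loc Q) (w : List α) : ∀ p, Q p :=
  w.foldl (fun s a => B.trans a s) B.init

/-- The word language accepted by the asynchronous automaton. -/
def AsyncAut.lang {loc : α → Finset P} {Q : P → Type*}
    (B : AsyncAut α loc Q) : Set (List α) :=
  {w | B.run w ∈ B.final}

/-- The set of traces of words of `L`, represented by all their linearisations;
two languages have the same set of traces iff their `traceClosure`s coincide. -/
def traceClosure [DecidableEq P] (loc : α → Finset P) (L : Set (List α)) :
    Set (List α) :=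
  {w' | ∃ w ∈ L, TraceEquiv loc w w'}

/-- The communication graph on the (indices of the) bags via their outer
processes: two distinct bags are adjacent iff their outer processes share a
letter. -/
def commGraphOuter {ι : Type*} (loc : α → Finset P) (out : ι → P) :
    SimpleGraph ι where
  Adj j j' := j ≠ j' ∧ ∃ a : α, out j ∈ loc a ∧ out j' ∈ loc a
  symm := ⟨fun _ _ h => ⟨h.1.symm, h.2.imp fun _ ha => ⟨ha.2, ha.1⟩⟩⟩
  loopless := ⟨fun _ h => h.1 rfl⟩

namespace DistTrace

section Views

variable {β : Type*} [DecidableEq P] (loc : β → Finset P)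

/-- The processes occurring in the causal past of the processes of `S` in a word. -/
def past (S : Finset P) : List β → Finset P
  | [] => S
  | a :: w => if Disjoint (loc a) (past S w) then past S w else past S w ∪ loc a

/-- The view of `S` on a word: the events in the causal past of the processes of `S`. -/
def view (S : Finset P) : List β → List β
  | [] => []
  | a :: w => if Disjoint (loc a) (past loc S w) then view S w else a :: view S w

/-- The events outside of the view of `S`. -/
def rest (S : Finset P) : List β → List β
  | [] => []
  | a :: w => if Disjoint (loc a) (past loc S w) then a :: rest S w else rest S w

/-- The events of a single process. -/
def proj (p : P) (w : List β) : List β := w.filter fun a => decide (p ∈ loc a)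

/-- Equality of traces, expressed by the equality of all projections on a single process. -/
def Eqv (u v : List β) : Prop := ∀ p, proj loc p u = proj loc p v

variable {loc}

theorem Eqv.refl (u : List β) : Eqv loc u u := fun _ => rfl

theorem Eqv.symm {u v : List β} (h : Eqv loc u v) : Eqv loc v u := fun p => (h p).symm

theorem Eqv.trans {u v w : List β} (h : Eqv loc u v) (h' : Eqv loc v w) : Eqv loc u w :=
  fun p => (h p).trans (h' p)

theorem proj_append (p : P) (u v : List β) : proj loc p (u ++ v) = proj loc p u ++ proj loc p v :=
  List.filter_append u v

theorem proj_filter (p : P) (f : β → Bool) (u : List β) :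
    proj loc p (u.filter f) = (proj loc p u).filter f := by
  simp only [proj, List.filter_filter, Bool.and_comm]

theorem proj_eq_nil {p : P} {u : List β} : proj loc p u = [] ↔ ∀ a ∈ u, p ∉ loc a := by
  simp [proj]

theorem mem_proj {p : P} {u : List β} {a : β} : a ∈ proj loc p u ↔ a ∈ u ∧ p ∈ loc a := by
  simp [proj]

theorem proj_singleton_of_mem {p : P} {a : β} (h : p ∈ loc a) : proj loc p [a] = [a] := by
  simp [proj, h]

theorem proj_singleton_of_notMem {p : P} {a : β} (h : p ∉ loc a) : proj loc p [a] = [] := by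
  simp [proj, h]

theorem Eqv.append {u v u' v' : List β} (h : Eqv loc u u') (h' : Eqv loc v v') :
    Eqv loc (u ++ v) (u' ++ v') := fun p => by rw [proj_append, proj_append, h p, h' p]

theorem Eqv.append_left_cancel {u u' v v' : List β} (h : Eqv loc (u ++ v) (u' ++ v'))
    (hu : Eqv loc u u') : Eqv loc v v' := fun p => by
  have := h p
  rw [proj_append, proj_append, hu p] at this
  exact List.append_cancel_left this

theorem Eqv.filter {u v : List β} (h : Eqv loc u v) (f : β → Bool) :
    Eqv loc (u.filter f) (v.filter f) := fun p => by
  rw [proj_filter, proj_filter, h p]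

theorem Eqv.mem_iff (hloc : ∀ a, (loc a).Nonempty) {u v : List β} (h : Eqv loc u v) {a : β} :
    a ∈ u ↔ a ∈ v := by
  obtain ⟨p, hp⟩ := hloc a
  have h1 : a ∈ proj loc p u ↔ a ∈ proj loc p v := by rw [h p]
  simpa [mem_proj, hp] using h1

theorem past_append (S : Finset P) (u v : List β) :
    past loc S (u ++ v) = past loc (past loc S v) u := by
  induction u with
  | nil => rfl
  | cons a u ih => simp only [List.cons_append, past, ih]

theorem view_append (S : Finset P) (u v : List β) :
    view loc S (u ++ v) = view loc (past loc S v) u ++ view loc S v := by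
  induction u with
  | nil => rfl
  | cons a u ih => simp only [List.cons_append, view, past_append, ih]; split_ifs <;> rfl

theorem rest_append (S : Finset P) (u v : List β) :
    rest loc S (u ++ v) = rest loc (past loc S v) u ++ rest loc S v := by
  induction u with
  | nil => rfl
  | cons a u ih => simp only [List.cons_append, rest, past_append, ih]; split_ifs <;> rfl

theorem view_concat_of_disjoint {S : Finset P} {a : β} (h : Disjoint (loc a) S) (w : List β) :
    view loc S (w ++ [a]) = view loc S w := by
  simp [view_append, view, past, h]

theorem view_concat_of_not_disjoint {S : Finset P} {a : β} (h : ¬ Disjoint (loc a) S)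
    (w : List β) : view loc S (w ++ [a]) = view loc (S ∪ loc a) w ++ [a] := by
  simp [view_append, view, past, h]

theorem rest_concat_of_disjoint {S : Finset P} {a : β} (h : Disjoint (loc a) S) (w : List β) :
    rest loc S (w ++ [a]) = rest loc S w ++ [a] := by
  simp [rest_append, rest, past, h]

theorem rest_concat_of_not_disjoint {S : Finset P} {a : β} (h : ¬ Disjoint (loc a) S)
    (w : List β) : rest loc S (w ++ [a]) = rest loc (S ∪ loc a) w := by
  simp [rest_append, rest, past, h]

theorem view_singleton_concat_of_mem {p : P} {a : β} (h : p ∈ loc a) (w : List β) :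
    view loc {p} (w ++ [a]) = view loc (loc a) w ++ [a] := by
  rw [view_concat_of_not_disjoint (by simpa using h),
    Finset.union_eq_right.2 (Finset.singleton_subset_iff.2 h)]

theorem view_singleton_concat_of_notMem {p : P} {a : β} (h : p ∉ loc a) (w : List β) :
    view loc {p} (w ++ [a]) = view loc {p} w :=
  view_concat_of_disjoint (by simpa using h) w

theorem view_empty (w : List β) : view loc ∅ w = [] := by
  induction w using List.reverseRecOn with
  | nil => rfl
  | append_singleton w a ih => rw [view_concat_of_disjoint (by simp), ih]

theorem view_univ [Fintype P] (hloc : ∀ a, (loc a).Nonempty) (w : List β) :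
    view loc Finset.univ w = w := by
  induction w using List.reverseRecOn with
  | nil => rfl
  | append_singleton w a ih =>
    rw [view_concat_of_not_disjoint, Finset.union_eq_left.2 (Finset.subset_univ _), ih]
    exact Finset.not_disjoint_iff.2 ⟨_, (hloc a).choose_spec, Finset.mem_univ _⟩

theorem subset_past (S : Finset P) (w : List β) : S ⊆ past loc S w := by
  induction w with
  | nil => exact subset_rfl
  | cons a w ih =>
    simp only [past]
    split_ifs
    · exact ih
    · exact ih.trans Finset.subset_union_left

theorem past_mono {S T : Finset P} (hST : S ⊆ T) {u v : List β} (h : u.Sublist v) :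
    past loc S u ⊆ past loc T v := by
  induction h with
  | slnil => exact hST
  | cons a _ ih =>
    simp only [past]
    split_ifs
    · exact ih
    · exact ih.trans Finset.subset_union_left
  | cons_cons a _ ih =>
    simp only [past]
    split_ifs with h1 h2 h2
    · exact ih
    · exact ih.trans Finset.subset_union_left
    · exact absurd (h2.mono_right ih) h1
    · exact Finset.union_subset_union_left ih

theorem view_sublist_view {S T : Finset P} (hST : S ⊆ T) {u v : List β} (h : u.Sublist v) :
    (view loc S u).Sublist (view loc T v) := by
  induction h with
  | slnil => exact List.Sublist.refl _
  | cons a _ ih =>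
    simp only [view]
    split_ifs
    · exact ih
    · exact ih.cons _
  | cons_cons a h ih =>
    simp only [view]
    split_ifs with h1 h2 h2
    · exact ih
    · exact ih.cons _
    · exact absurd (h2.mono_right (past_mono hST h)) h1
    · exact ih.cons_cons _

theorem view_sublist (S : Finset P) (w : List β) : (view loc S w).Sublist w := by
  induction w with
  | nil => exact List.Sublist.refl _
  | cons a w ih =>
    simp only [view]
    split_ifs
    · exact ih.cons _
    · exact ih.cons_cons _

theorem rest_sublist (S : Finset P) (w : List β) : (rest loc S w).Sublist w := by
  induction w with
  | nil => exact List.Sublist.refl _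
  | cons a w ih =>
    simp only [rest]
    split_ifs
    · exact ih.cons_cons _
    · exact ih.cons _

theorem length_view_add_length_rest (S : Finset P) (w : List β) :
    (view loc S w).length + (rest loc S w).length = w.length := by
  induction w with
  | nil => rfl
  | cons a w ih =>
    simp only [view, rest]
    split_ifs <;> simp <;> omega

theorem loc_subset_past_of_mem_view {S : Finset P} {w : List β} {a : β}
    (h : a ∈ view loc S w) : loc a ⊆ past loc S w := by
  induction w with
  | nil => simp [view] at h
  | cons b w ih =>
    simp only [view, past] at h ⊢
    split_ifs at h ⊢ with hb
    · exact ih h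
    · rcases List.mem_cons.1 h with rfl | h
      · exact Finset.subset_union_right
      · exact (ih h).trans Finset.subset_union_left

theorem disjoint_of_mem_rest {S : Finset P} {w : List β} {a : β}
    (h : a ∈ rest loc S w) : Disjoint (loc a) S := by
  induction w with
  | nil => simp [rest] at h
  | cons b w ih =>
    simp only [rest] at h
    split_ifs at h with hb
    · rcases List.mem_cons.1 h with rfl | h
      · exact hb.mono_right (subset_past S w)
      · exact ih h
    · exact ih h

theorem eqv_view_append_rest (S : Finset P) (w : List β) :
    Eqv loc w (view loc S w ++ rest loc S w) := by
  intro p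
  induction w with
  | nil => rfl
  | cons a w ih =>
    rw [proj_append] at ih ⊢
    simp only [view, rest]
    have hcons : ∀ v : List β, proj loc p (a :: v) = proj loc p [a] ++ proj loc p v :=
      fun v => proj_append p [a] v
    split_ifs with h
    · rw [hcons w, hcons (rest loc S w), ih]
      by_cases hp : p ∈ loc a
      · have : proj loc p (view loc S w) = [] := proj_eq_nil.2 fun b hb hpb =>
          Finset.disjoint_left.1 h hp (loc_subset_past_of_mem_view hb hpb)
        simp [this]
      · simp [proj_singleton_of_notMem hp]
    · rw [hcons w, hcons (view loc S w), ih, List.append_assoc]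

theorem view_view_of_subset {S T : Finset P} (h : T ⊆ S) (w : List β) :
    view loc T (view loc S w) = view loc T w := by
  induction w using List.reverseRecOn generalizing S T with
  | nil => rfl
  | append_singleton w a ih =>
    by_cases hS : Disjoint (loc a) S
    · rw [view_concat_of_disjoint hS, view_concat_of_disjoint (hS.mono_right h), ih h]
    · rw [view_concat_of_not_disjoint hS]
      by_cases hT : Disjoint (loc a) T
      · rw [view_concat_of_disjoint hT, view_concat_of_disjoint hT,
          ih (h.trans Finset.subset_union_left)]
      · rw [view_concat_of_not_disjoint hT, view_concat_of_not_disjoint hT,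
          ih (Finset.union_subset_union_left h)]

theorem view_view_of_superset {S T : Finset P} (h : S ⊆ T) (w : List β) :
    view loc T (view loc S w) = view loc S w := by
  induction w using List.reverseRecOn generalizing S T with
  | nil => rfl
  | append_singleton w a ih =>
    by_cases hS : Disjoint (loc a) S
    · rw [view_concat_of_disjoint hS, ih h]
    · rw [view_concat_of_not_disjoint hS,
        view_concat_of_not_disjoint fun hT => hS (hT.mono_right h),
        ih (Finset.union_subset_union_left h)]

theorem eqv_view_of_subset {S T : Finset P} (h : T ⊆ S) (w : List β) :
    Eqv loc (view loc S w) (view loc T w ++ rest loc T (view loc S w)) := by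
  have h' := eqv_view_append_rest (loc := loc) T (view loc S w)
  rwa [view_view_of_subset h] at h'

theorem proj_view_isPrefix {S T : Finset P} (h : T ⊆ S) (r : P) (w : List β) :
    proj loc r (view loc T w) <+: proj loc r (view loc S w) := by
  rw [eqv_view_of_subset h w r, proj_append]
  exact List.prefix_append _ _

theorem proj_view_of_mem {S : Finset P} {r : P} (h : r ∈ S) (w : List β) :
    proj loc r (view loc S w) = proj loc r w := by
  have hrest : proj loc r (rest loc S w) = [] := proj_eq_nil.2 fun a ha hr =>
    Finset.disjoint_left.1 (disjoint_of_mem_rest ha) hr h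
  rw [eqv_view_append_rest S w r, proj_append, hrest, List.append_nil]

theorem exists_proj_view_eq {S : Finset P} (hS : S.Nonempty) (r : P) (w : List β) :
    ∃ p ∈ S, proj loc r (view loc S w) = proj loc r (view loc {p} w) := by
  induction w using List.reverseRecOn generalizing S with
  | nil => exact ⟨hS.choose, hS.choose_spec, rfl⟩
  | append_singleton w a ih =>
    by_cases ha : Disjoint (loc a) S
    · obtain ⟨p, hp, h⟩ := ih hS
      refine ⟨p, hp, ?_⟩
      rw [view_concat_of_disjoint ha, h,
        view_singleton_concat_of_notMem fun h' => Finset.disjoint_left.1 ha h' hp]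
    · obtain ⟨p₀, hp₀, hp₀S⟩ := Finset.not_disjoint_iff.1 ha
      rw [view_concat_of_not_disjoint ha, proj_append]
      have key : proj loc r (view loc (S ∪ loc a) w) = proj loc r (view loc (loc a) w) →
          ∃ p ∈ S, proj loc r (view loc (S ∪ loc a) w) ++ proj loc r [a] =
            proj loc r (view loc {p} (w ++ [a])) := fun h =>
        ⟨p₀, hp₀S, by rw [view_singleton_concat_of_mem hp₀, proj_append, h]⟩
      by_cases hr : r ∈ loc a
      · exact key (by
          rw [proj_view_of_mem hr, proj_view_of_mem (Finset.mem_union_right _ hr)])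
      · obtain ⟨p, hp, h⟩ := ih (S := S ∪ loc a) (hS.mono Finset.subset_union_left)
        by_cases hpa : p ∈ loc a
        · refine key (List.IsPrefix.eq_of_length_le ?_ ?_)
          · rw [h]
            exact proj_view_isPrefix (Finset.singleton_subset_iff.2 hpa) r w
          · exact (proj_view_isPrefix Finset.subset_union_right r w).length_le
        · refine ⟨p, (Finset.mem_union.1 hp).resolve_right hpa, ?_⟩
          rw [view_singleton_concat_of_notMem hpa, h, proj_singleton_of_notMem hr,
            List.append_nil]

theorem proj_view_union (S T : Finset P) (r : P) (w : List β) :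
    proj loc r (view loc (S ∪ T) w) = proj loc r (view loc S w) ∨
      proj loc r (view loc (S ∪ T) w) = proj loc r (view loc T w) := by
  rcases (S ∪ T).eq_empty_or_nonempty with h | h
  · left
    rw [h, (Finset.union_eq_empty.1 h).1]
  · obtain ⟨p, hp, h⟩ := exists_proj_view_eq h r w
    have key : ∀ U : Finset P, U ⊆ S ∪ T → p ∈ U →
        proj loc r (view loc (S ∪ T) w) = proj loc r (view loc U w) := fun U hU hpU => by
      refine (List.IsPrefix.eq_of_length_le (proj_view_isPrefix hU r w) ?_).symm
      rw [h]
      exact (proj_view_isPrefix (Finset.singleton_subset_iff.2 hpU) r w).length_le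
    rcases Finset.mem_union.1 hp with hp | hp
    · exact .inl (key S Finset.subset_union_left hp)
    · exact .inr (key T Finset.subset_union_right hp)

/-- If every letter lies in `A` or in `B`, then `A ∩ B` carries the common past of `A` and `B`. -/
theorem view_view_of_separated {A B S T : Finset P} (w : List β)
    (hw : ∀ a ∈ w, loc a ⊆ A ∨ loc a ⊆ B) (hS : S ⊆ A) (hT : T ⊆ B)
    (hAS : A ∩ B ⊆ S) (hBT : A ∩ B ⊆ T) :
    view loc S (view loc T w) = view loc (A ∩ B) w := by
  induction w using List.reverseRecOn generalizing A B S T with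
  | nil => rfl
  | append_singleton w a ih =>
    have hw' : ∀ b ∈ w, loc b ⊆ A ∨ loc b ⊆ B := fun b hb => hw b (by simp [hb])
    by_cases hZ : Disjoint (loc a) (A ∩ B)
    · rw [view_concat_of_disjoint hZ]
      rcases hw a (by simp) with ha | ha
      · rw [view_concat_of_disjoint, ih hw' hS hT hAS hBT]
        exact Finset.disjoint_left.2 fun p hp hpT =>
          Finset.disjoint_left.1 hZ hp (Finset.mem_inter.2 ⟨ha hp, hT hpT⟩)
      · have hdis : Disjoint (loc a) S := Finset.disjoint_left.2 fun p hp hpS =>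
          Finset.disjoint_left.1 hZ hp (Finset.mem_inter.2 ⟨hS hpS, ha hp⟩)
        by_cases haT : Disjoint (loc a) T
        · rw [view_concat_of_disjoint haT, ih hw' hS hT hAS hBT]
        · rw [view_concat_of_not_disjoint haT, view_concat_of_disjoint hdis,
            ih hw' hS (Finset.union_subset hT ha) hAS (hBT.trans Finset.subset_union_left)]
    · have h' : ∀ {U}, A ∩ B ⊆ U → ¬ Disjoint (loc a) U := fun hU h => hZ (h.mono_right hU)
      rw [view_concat_of_not_disjoint hZ, view_concat_of_not_disjoint (h' hBT),
        view_concat_of_not_disjoint (h' hAS)]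
      congr 1
      rcases hw a (by simp) with ha | ha
      · have hAB : A ∩ (B ∪ loc a) = A ∩ B ∪ loc a := by
          rw [Finset.inter_union_distrib_left, Finset.inter_eq_right.2 ha]
        rw [← hAB]
        refine ih (fun b hb => (hw' b hb).imp_right fun h => h.trans Finset.subset_union_left)
          (Finset.union_subset hS ha) (Finset.union_subset_union_left hT) ?_ ?_
        all_goals rw [hAB]; exact Finset.union_subset_union_left ‹_›
      · have hAB : (A ∪ loc a) ∩ B = A ∩ B ∪ loc a := by
          rw [Finset.union_inter_distrib_right, Finset.inter_eq_left.2 ha]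
        rw [← hAB]
        refine ih (fun b hb => (hw' b hb).imp_left fun h => h.trans Finset.subset_union_left)
          (Finset.union_subset_union_left hS) (Finset.union_subset hT ha) ?_ ?_
        all_goals rw [hAB]; exact Finset.union_subset_union_left ‹_›

theorem past_disjoint {S R : Finset P} {w : List β} (hS : Disjoint S R)
    (hw : ∀ a ∈ w, Disjoint (loc a) R) : Disjoint (past loc S w) R := by
  induction w with
  | nil => exact hS
  | cons a w ih =>
    simp only [past]
    have := ih fun b hb => hw b (by simp [hb])
    split_ifs
    · exact this
    · exact Finset.disjoint_union_left.2 ⟨this, hw a (by simp)⟩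

/-- The last occurrence of a letter satisfying `f`. -/
theorem exists_last {f : β → Prop} {w : List β} (h : ∃ a ∈ w, f a) :
    ∃ u a v, w = u ++ a :: v ∧ f a ∧ ∀ b ∈ v, ¬ f b := by
  induction w with
  | nil => simp at h
  | cons b w ih =>
    by_cases hw : ∃ a ∈ w, f a
    · obtain ⟨u, a, v, rfl, ha, hv⟩ := ih hw
      exact ⟨b :: u, a, v, rfl, ha, hv⟩
    · push Not at hw
      refine ⟨[], b, w, rfl, ?_, hw⟩
      obtain ⟨a, ha, hfa⟩ := h
      rcases List.mem_cons.1 ha with rfl | ha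
      · exact hfa
      · exact absurd hfa (hw a ha)

theorem exists_first {f : β → Prop} {w : List β} (h : ∃ a ∈ w, f a) :
    ∃ u a v, w = u ++ a :: v ∧ f a ∧ ∀ b ∈ u, ¬ f b := by
  obtain ⟨u, a, v, hw, ha, hv⟩ := exists_last (f := f) (w := w.reverse) (by simpa using h)
  refine ⟨v.reverse, a, u.reverse, ?_, ha, by simpa using hv⟩
  rw [← List.reverse_reverse w, hw]
  simp

/-- A maximal event of the view of `S` involves a process of `S`. -/
theorem not_disjoint_of_eqv_concat (hloc : ∀ a, (loc a).Nonempty) {S : Finset P} {w u : List β}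
    {f : β} (h : Eqv loc (view loc S w) (u ++ [f])) : ¬ Disjoint (loc f) S := by
  intro hdis
  obtain ⟨x, e, y, hxy, he, hy⟩ : ∃ x e y, view loc S w = x ++ e :: y ∧
      ¬ Disjoint (loc e) (loc f) ∧ ∀ b ∈ y, ¬ ¬ Disjoint (loc b) (loc f) := by
    refine exists_last ⟨f, (h.mem_iff hloc).2 (by simp), ?_⟩
    simpa using (hloc f).ne_empty
  obtain ⟨p, hpe, hpf⟩ := Finset.not_disjoint_iff.1 he
  have hy' : ∀ b ∈ y, Disjoint (loc b) (loc f) := fun b hb => not_not.1 (hy b hb)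
  have hef : e = f := by
    have h1 := h p
    have h2 : proj loc p y = [] :=
      proj_eq_nil.2 fun b hb hpb => Finset.disjoint_left.1 (hy' b hb) hpb hpf
    rw [hxy, List.append_cons, proj_append, proj_append, proj_append, h2,
      proj_singleton_of_mem hpe, proj_singleton_of_mem hpf, List.append_nil] at h1
    simpa using (List.append_inj' h1 rfl).2
  subst hef
  have h1 : view loc S (view loc S w) = view loc S w := view_view_of_subset subset_rfl w
  have h2 : Disjoint (loc e) (past loc S y) := (past_disjoint hdis.symm hy').symm
  have h3 := congrArg List.length h1
  rw [hxy, view_append, view, if_pos h2] at h3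
  have h4 := (view_sublist (loc := loc) (past loc S (e :: y)) x).length_le
  have h5 := (view_sublist (loc := loc) S y).length_le
  simp at h3
  omega

theorem map_rest {γ : Type*} (f : γ → β) (S : Finset P) (w : List γ) :
    (rest (fun x => loc (f x)) S w).map f = rest loc S (w.map f) := by
  have hp : ∀ w : List γ, past (fun x => loc (f x)) S w = past loc S (w.map f) := by
    intro w
    induction w with
    | nil => rfl
    | cons a w ih => simp only [past, List.map_cons, ih]
  induction w with
  | nil => rfl
  | cons a w ih =>
    simp only [rest, List.map_cons, hp]
    split_ifs
    · simp [ih]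
    · exact ih

theorem map_proj {γ : Type*} (f : γ → β) (p : P) (w : List γ) :
    (proj (fun x => loc (f x)) p w).map f = proj loc p (w.map f) := by
  simp only [proj, List.filter_map]; rfl

end Views

section Equivalence

variable [DecidableEq P] {loc : α → Finset P}

theorem eqv_of_swapAdj {u v : List α} (h : SwapAdj loc u v) : Eqv loc u v := by
  obtain ⟨x, y, a, b, hab, rfl, rfl⟩ := h
  refine (Eqv.refl x).append (fun p => ?_)
  by_cases ha : p ∈ loc a
  · have hb : p ∉ loc b := fun hb => by
      simpa [hab] using Finset.mem_inter.2 ⟨ha, hb⟩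
    simp [proj, ha, hb]
  · by_cases hb : p ∈ loc b <;> simp [proj, ha, hb]

theorem eqv_of_traceEquiv {u v : List α} (h : TraceEquiv loc u v) : Eqv loc u v := by
  induction h with
  | refl => exact Eqv.refl u
  | tail _ h ih => exact ih.trans (eqv_of_swapAdj h)

theorem traceEquiv_cons {u v : List α} (a : α) (h : TraceEquiv loc u v) :
    TraceEquiv loc (a :: u) (a :: v) := by
  induction h with
  | refl => exact .refl
  | tail _ h ih =>
    obtain ⟨x, y, b, c, hbc, rfl, rfl⟩ := h
    exact ih.tail ⟨a :: x, y, b, c, hbc, rfl, rfl⟩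

theorem traceEquiv_cons_append {x : List α} {a : α} (h : ∀ b ∈ x, Disjoint (loc b) (loc a))
    (y : List α) : TraceEquiv loc (a :: (x ++ y)) (x ++ a :: y) := by
  induction x with
  | nil => exact .refl
  | cons b x ih =>
    refine .head ⟨[], x ++ y, a, b, ?_, rfl, rfl⟩
      (traceEquiv_cons b (ih fun c hc => h c (by simp [hc])))
    exact Finset.disjoint_iff_inter_eq_empty.1 (h b (by simp)).symm

theorem traceEquiv_of_eqv (hloc : ∀ a, (loc a).Nonempty) {u v : List α} (h : Eqv loc u v) :
    TraceEquiv loc u v := by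
  induction u generalizing v with
  | nil =>
    cases v with
    | nil => exact .refl
    | cons b v => simpa using (h.mem_iff hloc (a := b)).2 (by simp)
  | cons a u ih =>
    obtain ⟨x, e, y, rfl, he, hx⟩ : ∃ x e y, v = x ++ e :: y ∧
        ¬ Disjoint (loc e) (loc a) ∧ ∀ b ∈ x, ¬ ¬ Disjoint (loc b) (loc a) := by
      refine exists_first ⟨a, (h.mem_iff hloc).1 (by simp), ?_⟩
      simpa using (hloc a).ne_empty
    have hx' : ∀ b ∈ x, Disjoint (loc b) (loc a) := fun b hb => not_not.1 (hx b hb)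
    obtain ⟨p, hpe, hpa⟩ := Finset.not_disjoint_iff.1 he
    have hea : e = a := by
      have h1 := h p
      have h2 : proj loc p x = [] :=
        proj_eq_nil.2 fun b hb hpb => Finset.disjoint_left.1 (hx' b hb) hpb hpa
      rw [proj_append, h2] at h1
      simp only [proj, hpa, hpe, decide_true, List.filter_cons_of_pos, List.nil_append,
        List.cons.injEq] at h1
      exact h1.1.symm
    subst hea
    have h3 := traceEquiv_cons_append hx' y
    have h4 : Eqv loc ([e] ++ u) ([e] ++ (x ++ y)) := h.trans (eqv_of_traceEquiv h3).symm
    exact (traceEquiv_cons e (ih (h4.append_left_cancel (Eqv.refl _)))).trans h3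

theorem Eqv.perm (hloc : ∀ a, (loc a).Nonempty) {u v : List α} (h : Eqv loc u v) :
    u.Perm v := by
  have h' := traceEquiv_of_eqv hloc h
  clear h
  induction h' with
  | refl => exact .refl _
  | tail _ h ih =>
    obtain ⟨x, y, a, b, -, rfl, rfl⟩ := h
    exact ih.trans ((List.Perm.swap b a y).append_left x)

theorem Eqv.length_eq (hloc : ∀ a, (loc a).Nonempty) {u v : List α} (h : Eqv loc u v) :
    u.length = v.length := (h.perm hloc).length_eq

end Equivalence

section Run

variable {Q : Type*} {A : DetAut α Q}

theorem run_append (q : Q) (u v : List α) :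
    A.run q (u ++ v) = (A.run q u).bind fun q' => A.run q' v :=
  List.foldlM_append

theorem run_append_of_eq {q q' : Q} {u : List α} (h : A.run q u = some q') (v : List α) :
    A.run q (u ++ v) = A.run q' v := by
  rw [run_append, h]; rfl

variable [DecidableEq P] {loc : α → Finset P}

theorem run_cons_cons_of_diamond (hA : A.Diamond loc) {a b : α} (hab : loc a ∩ loc b = ∅)
    {q q' : Q} {v : List α} (h : A.run q (a :: b :: v) = some q') :
    A.run q (b :: a :: v) = some q' := by
  simp only [DetAut.run, List.foldlM_cons, Option.bind_eq_bind, Option.bind_eq_some_iff] at h ⊢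
  obtain ⟨q₁, h₁, q₂, h₂, h₃⟩ := h
  obtain ⟨q₃, h₄, h₅⟩ := hA a b q q₁ q₂ hab h₁ h₂
  exact ⟨q₃, h₄, q₂, h₅, h₃⟩

theorem run_swap (hA : A.Diamond loc) {u v : List α} (h : SwapAdj loc u v) {q q' : Q}
    (hu : A.run q u = some q') : A.run q v = some q' := by
  obtain ⟨x, y, a, b, hab, rfl, rfl⟩ := h
  rw [run_append, Option.bind_eq_some_iff] at hu ⊢
  obtain ⟨q₁, h₁, h₂⟩ := hu
  exact ⟨q₁, h₁, run_cons_cons_of_diamond hA hab h₂⟩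

theorem run_traceEquiv (hA : A.Diamond loc) {u v : List α} (h : TraceEquiv loc u v) {q q' : Q}
    (hu : A.run q u = some q') : A.run q v = some q' := by
  induction h with
  | refl => exact hu
  | tail _ h ih => exact run_swap hA h ih

theorem run_eqv (hloc : ∀ a, (loc a).Nonempty) (hA : A.Diamond loc) {u v : List α}
    (h : Eqv loc u v) (q : Q) : A.run q u = A.run q v := by
  ext q'
  exact ⟨run_traceEquiv hA (traceEquiv_of_eqv hloc h),
    run_traceEquiv hA (traceEquiv_of_eqv hloc h.symm)⟩

/-- If `x` and `y` are independent of each other, then the state reached from `q` by `x y` depends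
only on the states reached from `q` by `x` and by `y`. -/
theorem run_append_eq_of_run_eq (hloc : ∀ a, (loc a).Nonempty) (hA : A.Diamond loc)
    {x y x' y' : List α} {q₀ qx qy q : Q}
    (hxy : ∀ a ∈ x', ∀ b ∈ y, Disjoint (loc a) (loc b))
    (hxy' : ∀ a ∈ x', ∀ b ∈ y', Disjoint (loc a) (loc b))
    (hx : A.run q₀ x = some qx) (hx' : A.run q₀ x' = some qx)
    (hy : A.run q₀ y = some qy) (hy' : A.run q₀ y' = some qy)
    (h : A.run q₀ (x' ++ y') = some q) : A.run q₀ (x ++ y) = some q := by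
  have comm : ∀ {u v : List α}, (∀ a ∈ u, ∀ b ∈ v, Disjoint (loc a) (loc b)) →
      A.run q₀ (u ++ v) = A.run q₀ (v ++ u) := fun {u v} huv => by
    refine run_eqv hloc hA (fun p => ?_) q₀
    rw [proj_append, proj_append]
    by_cases hp : ∃ a ∈ u, p ∈ loc a
    · obtain ⟨a, ha, hpa⟩ := hp
      have : proj loc p v = [] :=
        proj_eq_nil.2 fun b hb hpb => Finset.disjoint_left.1 (huv a ha b hb) hpa hpb
      simp [this]
    · have : proj loc p u = [] := proj_eq_nil.2 fun b hb hpb => hp ⟨b, hb, hpb⟩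
      simp [this]
  rw [run_append_of_eq hx, ← run_append_of_eq hx', comm hxy, run_append_of_eq hy,
    ← run_append_of_eq hy', ← comm hxy', h]

end Run

section Assembly

open Classical in
/-- An asynchronous automaton whose local states are given by a function of the word read so far. -/
theorem exists_asyncAut_of_localState {loc : α → Finset P} {L : Set (List α)} {R : P → Type*}
    [∀ p, Finite (R p)] (σ : List α → ∀ p, R p)
    (hσ : ∀ w a p, p ∉ loc a → σ (w ++ [a]) p = σ w p)
    (hcongr : ∀ w w' a, (∀ q ∈ loc a, σ w q = σ w' q) →
      ∀ p ∈ loc a, σ (w ++ [a]) p = σ (w' ++ [a]) p)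
    (hL : ∀ w w', σ w = σ w' → w ∈ L → w' ∈ L) :
    ∃ (Q : P → Type) (inst : ∀ p, Fintype (Q p)) (B : AsyncAut α loc Q),
      B.lang = L ∧
        ∀ p, @Fintype.card (Q p) (inst p) = Nat.card (Set.range fun w => σ w p) := by
  let e : ∀ p, Set.range (fun w => σ w p) ≃ Fin (Nat.card (Set.range fun w => σ w p)) :=
    fun p => Finite.equivFin _
  let τ : List α → ∀ p, Fin (Nat.card (Set.range fun w => σ w p)) := fun w p => e p ⟨σ w p, w, rfl⟩
  have hτ : ∀ {w w' p}, τ w p = τ w' p ↔ σ w p = σ w' p :=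
    fun {_ _ p} => (e p).injective.eq_iff.trans Subtype.mk_eq_mk
  let rep : α → (∀ p, Fin (Nat.card (Set.range fun w => σ w p))) → List α := fun a s =>
    Classical.epsilon fun w => ∀ q ∈ loc a, τ w q = s q
  let B : AsyncAut α loc fun p => Fin (Nat.card (Set.range fun w => σ w p)) :=
    { init := τ []
      trans := fun a s p => if p ∈ loc a ∧ ∀ q ∈ loc a, τ (rep a s) q = s q
        then τ (rep a s ++ [a]) p else s p
      final := {s | ∃ w ∈ L, τ w = s}
      trans_untouched := fun a s p hp => if_neg fun h => hp h.1
      trans_local := fun a s s' h p hp => by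
        have h1 : rep a s = rep a s' := by
          simp only [rep]
          congr! 4 with w q hq
          rw [h q hq]
        have h2 : (∀ q ∈ loc a, τ (rep a s) q = s q) ↔ ∀ q ∈ loc a, τ (rep a s') q = s' q :=
          forall₂_congr fun q hq => by rw [h1, h q hq]
        exact if_congr (and_congr Iff.rfl h2) (by rw [h1]) (h p hp) }
  have hrun : ∀ w, B.run w = τ w := fun w => by
    induction w using List.reverseRecOn with
    | nil => rfl
    | append_singleton w a ih =>
      have h1 : B.run (w ++ [a]) = B.trans a (B.run w) := by simp [AsyncAut.run]
      rw [h1, ih]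
      funext p
      have hrep : ∀ q ∈ loc a, τ (rep a (τ w)) q = τ w q :=
        Classical.epsilon_spec (p := fun v => ∀ q ∈ loc a, τ v q = τ w q) ⟨w, fun _ _ => rfl⟩
      by_cases hp : p ∈ loc a
      · simp only [B, if_pos (And.intro hp hrep)]
        exact hτ.2 (hcongr _ _ a (fun q hq => hτ.1 (hrep q hq)) p hp)
      · simp only [B, if_neg (fun h : p ∈ loc a ∧ _ => hp h.1)]
        exact hτ.2 (hσ w a p hp).symm
  refine ⟨_, fun p => inferInstance, B, ?_, fun p => Fintype.card_fin _⟩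
  ext w
  simp only [AsyncAut.lang, Set.mem_ofPred_eq, hrun]
  constructor
  · rintro ⟨v, hv, h⟩
    exact hL v w (funext fun p => hτ.1 (congrFun h p)) hv
  · exact fun hw => ⟨w, hw, rfl⟩

end Assembly

section Levels

variable [DecidableEq P] (loc : α → Finset P) (k : ℕ)

/-- Auxiliary function for `tag`, where `u` is the word preceding the word to be tagged. -/
def tagAux (u : List α) : List α → List (α × ℤ)
  | [] => []
  | a :: w => (a, ((view loc (loc a) u).length : ℤ) / k) :: tagAux (u ++ [a]) w

/-- Every event is tagged with its level, the number of events in its strict causal past divided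
by `k`. -/
def tag (w : List α) : List (α × ℤ) := tagAux loc k [] w

/-- The events of level `c`. -/
def level (w : List α) (c : ℤ) : List α :=
  ((tag loc k w).filter fun x => decide (x.2 = c)).map Prod.fst

/-- An upper bound for the levels of the events of a word. -/
def topLevel (w : List α) : ℤ := ((w.length : ℤ) + 1) / k

/-- Any independent suffix of a word that does not involve some process of `B` is shorter than
`k`. -/
def Fair (B : Finset P) (w : List α) : Prop :=
  ∀ x y, Eqv loc w (x ++ y) → ∀ r ∈ B, (∀ c ∈ y, r ∉ loc c) → y.length < k

/-- The lengths agree modulo `2 * k` and the three topmost levels agree. -/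
def CodeEq (w w' : List α) : Prop :=
  (w.length : ℤ) % (2 * k) = (w'.length : ℤ) % (2 * k) ∧
    ∀ d ≤ 2, Eqv loc (level loc k w (topLevel k w - d)) (level loc k w' (topLevel k w' - d))

variable {loc k}

theorem tagAux_append (u v w : List α) :
    tagAux loc k u (v ++ w) = tagAux loc k u v ++ tagAux loc k (u ++ v) w := by
  induction v generalizing u with
  | nil => simp [tagAux]
  | cons a v ih => simp [tagAux, ih]

theorem tag_concat (w : List α) (a : α) :
    tag loc k (w ++ [a]) = tag loc k w ++ [(a, ((view loc (loc a) w).length : ℤ) / k)] := by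
  simp [tag, tagAux_append, tagAux]

theorem map_fst_tag (w : List α) : (tag loc k w).map Prod.fst = w := by
  induction w using List.reverseRecOn with
  | nil => rfl
  | append_singleton w a ih => simp [tag_concat, ih]

theorem tag_view (S : Finset P) (w : List α) :
    tag loc k (view loc S w) = view (fun x : α × ℤ => loc x.1) S (tag loc k w) := by
  induction w using List.reverseRecOn generalizing S with
  | nil => rfl
  | append_singleton w a ih =>
    by_cases h : Disjoint (loc a) S
    · rw [view_concat_of_disjoint h, tag_concat, view_concat_of_disjoint (by exact h), ih]
    · rw [view_concat_of_not_disjoint h, tag_concat, tag_concat,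
        view_concat_of_not_disjoint (by exact h), ih,
        view_view_of_subset Finset.subset_union_right]

theorem view_length_le (S : Finset P) (w : List α) : (view loc S w).length ≤ w.length :=
  (view_sublist S w).length_le

theorem tag_bounds (hk : 1 ≤ k) {w : List α} {a : α} {c : ℤ} (h : (a, c) ∈ tag loc k w) :
    0 ≤ c ∧ c * k + 1 ≤ w.length := by
  induction w using List.reverseRecOn with
  | nil => simp [tag, tagAux] at h
  | append_singleton w b ih =>
    rw [tag_concat, List.mem_append, List.mem_singleton] at h
    rw [List.length_append, List.length_singleton, Nat.cast_add, Nat.cast_one]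
    rcases h with h | h
    · exact ⟨(ih h).1, by linarith [(ih h).2]⟩
    · obtain ⟨-, rfl⟩ := Prod.mk.inj h
      have h1 : ((view loc (loc b) w).length : ℤ) ≤ w.length := by
        exact_mod_cast view_length_le _ _
      exact ⟨by positivity, by
        linarith [Int.ediv_mul_le ((view loc (loc b) w).length : ℤ) (b := k) (by omega)]⟩

theorem tag_le_of_mem (hk : 1 ≤ k) {w : List α} {a : α} {c : ℤ} {S : Finset P} {r : P}
    (h : (a, c) ∈ tag loc k w) (hra : r ∈ loc a) (hrS : r ∈ S) :
    c ≤ ((view loc S w).length : ℤ) / k := by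
  have h1 : (a, c) ∈ tag loc k (view loc S w) := by
    rw [tag_view]
    have h2 : (a, c) ∈ proj (fun x : α × ℤ => loc x.1) r (tag loc k w) := mem_proj.2 ⟨h, hra⟩
    rw [← proj_view_of_mem hrS] at h2
    exact (mem_proj.1 h2).1
  exact (Int.le_ediv_iff_mul_le (by omega)).2 (by linarith [(tag_bounds hk h1).2])

theorem length_filter_le_tag (hk : 1 ≤ k) (w : List α) (c : ℤ) :
    (((tag loc k w).filter fun x => decide (c ≤ x.2)).length : ℤ) ≤ max 0 (w.length - c * k) := by
  induction w using List.reverseRecOn with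
  | nil => simp [tag, tagAux]
  | append_singleton w b ih =>
    rw [tag_concat, List.filter_append, List.length_append, List.length_append,
      List.length_singleton, Nat.cast_add, Nat.cast_add, Nat.cast_one]
    by_cases h : c ≤ ((view loc (loc b) w).length : ℤ) / k
    · have h1 : ((view loc (loc b) w).length : ℤ) ≤ w.length := by
        exact_mod_cast view_length_le _ _
      have h2 := (Int.le_ediv_iff_mul_le (by omega)).1 h
      simp only [h, decide_true, List.filter_cons_of_pos, List.filter_nil, List.length_singleton]
      push_cast
      omega
    · simp only [h, decide_false, Bool.false_eq_true, not_false_eq_true, List.filter_cons_of_neg,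
        List.filter_nil, List.length_nil]
      push_cast
      omega

theorem pairwise_proj_tag (hk : 1 ≤ k) (r : P) (w : List α) :
    (proj (fun x : α × ℤ => loc x.1) r (tag loc k w)).Pairwise fun x y => x.2 ≤ y.2 := by
  induction w using List.reverseRecOn with
  | nil => simp [tag, tagAux, proj]
  | append_singleton w b ih =>
    rw [tag_concat, proj_append, List.pairwise_append]
    refine ⟨ih, ?_, ?_⟩
    · exact (List.pairwise_singleton _ _).sublist List.filter_sublist
    · rintro ⟨a, c⟩ hx y hy
      obtain ⟨hy, hr⟩ := mem_proj.1 hy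
      obtain ⟨hx, hra⟩ := mem_proj.1 hx
      obtain rfl := List.mem_singleton.1 hy
      exact tag_le_of_mem hk hx hra hr

theorem exists_split_of_mem_rest_tag {S : Finset P} {w : List α} {a : α} {c : ℤ}
    (h : (a, c) ∈ rest (fun x : α × ℤ => loc x.1) S (tag loc k w)) :
    ∃ n : ℕ, c = (n : ℤ) / k ∧ ∃ x y, Eqv loc (view loc S w) (x ++ y) ∧ x.length ≤ n ∧
      ∀ b ∈ y, Disjoint (loc b) (loc a) := by
  induction w using List.reverseRecOn generalizing S with
  | nil => simp [tag, tagAux, rest] at h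
  | append_singleton w b ih =>
    rw [tag_concat] at h
    by_cases hb : Disjoint (loc b) S
    · rw [rest_concat_of_disjoint (by exact hb), List.mem_append, List.mem_singleton] at h
      rw [view_concat_of_disjoint hb]
      rcases h with h | h
      · exact ih h
      · obtain ⟨rfl, rfl⟩ := Prod.mk.inj h
        exact ⟨_, rfl, _, _, eqv_view_append_rest (loc a) _,
          (view_sublist_view subset_rfl (view_sublist S w)).length_le,
          fun b hb => disjoint_of_mem_rest hb⟩
    · rw [rest_concat_of_not_disjoint (by exact hb)] at h
      rw [view_concat_of_not_disjoint hb]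
      obtain ⟨n, hn, x, y, hxy, hx, hy⟩ := ih h
      refine ⟨n, hn, x, y ++ [b], ?_, hx, fun d hd => ?_⟩
      · rw [← List.append_assoc]
        exact hxy.append (Eqv.refl _)
      · rcases List.mem_append.1 hd with hd | hd
        · exact hy d hd
        · obtain rfl := List.mem_singleton.1 hd
          exact (Disjoint.mono_right Finset.subset_union_right (disjoint_of_mem_rest h)).symm

theorem topLevel_le_of_mem_rest_tag (hloc : ∀ a, (loc a).Nonempty) (hk : 1 ≤ k)
    {S B : Finset P} {w : List α} (hw : ∀ a ∈ w, loc a ⊆ B) (hfair : Fair loc k B (view loc S w))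
    {x : α × ℤ} (h : x ∈ rest (fun x : α × ℤ => loc x.1) S (tag loc k w)) :
    topLevel k (view loc S w) - 1 ≤ x.2 := by
  obtain ⟨a, c⟩ := x
  obtain ⟨n, rfl, x, y, hxy, hx, hy⟩ := exists_split_of_mem_rest_tag h
  have ha : a ∈ w := by
    have h1 := List.mem_map_of_mem (f := Prod.fst) ((rest_sublist _ _).mem h)
    rwa [map_fst_tag] at h1
  obtain ⟨r, hr⟩ := hloc a
  have h1 := hfair x y hxy r (hw a ha hr) fun b hb hrb => Finset.disjoint_left.1 (hy b hb) hrb hr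
  have h2 := hxy.length_eq hloc
  rw [List.length_append] at h2
  have h3 : ((view loc S w).length : ℤ) + 1 ≤ n + 1 * k := by omega
  have h4 := Int.ediv_le_ediv (c := k) (by omega) h3
  rw [Int.add_mul_ediv_right _ _ (by omega)] at h4
  simp only [topLevel]
  linarith

theorem map_fst_eq_of_levels {β : Type*} {d : ℤ} {l l' : List (β × ℤ)}
    (hl : l.Pairwise fun x y => x.2 ≤ y.2) (hl' : l'.Pairwise fun x y => x.2 ≤ y.2)
    (h : ∀ c, (l.filter fun x => decide (x.2 = c)).map Prod.fst =
      (l'.filter fun x => decide (x.2 = c + d)).map Prod.fst) :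
    l.map Prod.fst = l'.map Prod.fst := by
  induction l generalizing l' with
  | nil =>
    cases l' with
    | nil => rfl
    | cons y l' => simpa using h (y.2 - d)
  | cons x l ih =>
    cases l' with
    | nil => simpa using h x.2
    | cons y l' =>
      rw [List.pairwise_cons] at hl hl'
      have hxy : y.2 = x.2 + d := by
        refine le_antisymm ?_ ?_
        · by_contra! hlt
          have h1 := h x.2
          rw [List.filter_cons_of_pos (by simp)] at h1
          have h2 : ((y :: l').filter fun z => decide (z.2 = x.2 + d)) = [] := by
            simp only [List.filter_eq_nil_iff, List.mem_cons, decide_eq_true_eq]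
            rintro z (rfl | hz)
            · exact hlt.ne'
            · exact (hlt.trans_le (hl'.1 z hz)).ne'
          simp [h2] at h1
        · by_contra! hlt
          have h1 := h (y.2 - d)
          rw [sub_add_cancel, List.filter_cons_of_pos (a := y) (by simp)] at h1
          have h2 : ((x :: l).filter fun z => decide (z.2 = y.2 - d)) = [] := by
            simp only [List.filter_eq_nil_iff, List.mem_cons, decide_eq_true_eq]
            rintro z (rfl | hz)
            · intro h3; omega
            · have := hl.1 z hz
              intro h3; omega
          simp [h2] at h1
      have hx : x.1 = y.1 := by
        have h1 := h x.2
        rw [List.filter_cons_of_pos (by simp), List.filter_cons_of_pos (by simp [hxy])] at h1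
        simpa using (List.cons.inj h1).1
      rw [List.map_cons, List.map_cons, hx, ih hl.2 hl'.2 fun c => ?_]
      have h1 := h c
      by_cases hc : x.2 = c
      · rw [List.filter_cons_of_pos (by simp [hc]),
          List.filter_cons_of_pos (by simp [hxy, hc])] at h1
        exact (List.cons.inj h1).2
      · rwa [List.filter_cons_of_neg (by simp [hc]),
          List.filter_cons_of_neg (by simp [hxy, hc])] at h1

end Levels

section Merge

variable [DecidableEq P] {loc : α → Finset P} {k : ℕ}

theorem proj_level (r : P) (w : List α) (c : ℤ) :
    proj loc r (level loc k w c) =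
      ((proj (fun x : α × ℤ => loc x.1) r (tag loc k w)).filter fun x => decide (x.2 = c)).map
        Prod.fst := by
  rw [level, ← map_proj, proj_filter]

theorem exists_proj_level_view_eq {S : Finset P} (hS : S.Nonempty) (r : P) (w : List α) :
    ∃ p ∈ S, ∀ c, proj loc r (level loc k (view loc S w) c) =
      proj loc r (level loc k (view loc {p} w) c) := by
  obtain ⟨p, hp, h⟩ := exists_proj_view_eq (loc := fun x : α × ℤ => loc x.1) hS r (tag loc k w)
  exact ⟨p, hp, fun c => by rw [proj_level, proj_level, tag_view, tag_view, h]⟩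

theorem proj_level_view_isPrefix {S T : Finset P} (h : T ⊆ S) (r : P) (w : List α) (c : ℤ) :
    proj loc r (level loc k (view loc T w) c) <+: proj loc r (level loc k (view loc S w) c) := by
  rw [proj_level, proj_level, tag_view, tag_view]
  exact ((proj_view_isPrefix h r _).filter _).map _

theorem level_view_eqv (S T : Finset P) (h : T ⊆ S) (w : List α) (c : ℤ) :
    Eqv loc (level loc k (view loc S w) c) (level loc k (view loc T w) c ++
      ((rest (fun x : α × ℤ => loc x.1) T (tag loc k (view loc S w))).filter
        fun x => decide (x.2 = c)).map Prod.fst) := by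
  intro r
  have h1 := (eqv_view_append_rest (loc := fun x : α × ℤ => loc x.1) T
    (tag loc k (view loc S w))).filter (fun x => decide (x.2 = c)) r
  rw [← tag_view, view_view_of_subset h, List.filter_append] at h1
  rw [level, ← map_proj, h1, map_proj, List.map_append]
  rfl

theorem length_view_singleton_sub_lt {B : Finset P} {p q : P} {w : List α}
    (hloc : ∀ a, (loc a).Nonempty) (hq : q ∈ B) (hfair : Fair loc k B (view loc {p} w)) :
    (view loc {p} w).length < (view loc {q} w).length + k := by
  have h := eqv_view_append_rest (loc := loc) {q} (view loc {p} w)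
  have h1 := hfair _ _ h q hq fun c hc hqc =>
    Finset.disjoint_left.1 (disjoint_of_mem_rest hc) hqc (by simp)
  have h2 := h.length_eq hloc
  have h3 := (view_sublist_view (loc := loc) (subset_refl {q})
    (view_sublist (loc := loc) {p} w)).length_le
  rw [List.length_append] at h2
  omega

theorem topLevel_eq (hk : 1 ≤ k) {w w' : List α} {d : ℤ}
    (h : (w'.length : ℤ) = w.length + 2 * k * d) : topLevel k w' = topLevel k w + 2 * d := by
  rw [topLevel, topLevel, h, show (w.length : ℤ) + 2 * k * d + 1 = w.length + 1 + 2 * d * k by ring,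
    Int.add_mul_ediv_right _ _ (by omega)]

/-- The offset between the lengths of two words with the same code is a multiple of `2 * k`. -/
theorem CodeEq.exists_offset {w w' : List α} (h : CodeEq loc k w w') :
    ∃ d : ℤ, (w'.length : ℤ) = w.length + 2 * k * d := by
  obtain ⟨d, hd⟩ := Int.ModEq.dvd h.1
  exact ⟨d, by linarith⟩

theorem CodeEq.level_eqv (hk : 1 ≤ k) {w w' : List α} (h : CodeEq loc k w w') {d : ℤ}
    (hd : (w'.length : ℤ) = w.length + 2 * k * d) {c : ℤ} (hc : topLevel k w - 2 ≤ c) :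
    Eqv loc (level loc k w c) (level loc k w' (c + 2 * d)) := by
  have h1 := h.2 (topLevel k w - c) (by linarith)
  rwa [topLevel_eq hk hd, sub_sub_cancel, show topLevel k w + 2 * d - (topLevel k w - c) =
    c + 2 * d by ring] at h1

theorem exists_common_offset (hloc : ∀ a, (loc a).Nonempty) {S B : Finset P}
    (hS : S.Nonempty) (hSB : S ⊆ B) {w w' : List α}
    (hfair : ∀ p ∈ S, Fair loc k B (view loc {p} w))
    (hfair' : ∀ p ∈ S, Fair loc k B (view loc {p} w'))
    (hcode : ∀ p ∈ S, CodeEq loc k (view loc {p} w) (view loc {p} w')) :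
    ∃ d : ℤ, ∀ p ∈ S, ((view loc {p} w').length : ℤ) = (view loc {p} w).length + 2 * k * d := by
  obtain ⟨q, hq⟩ := hS
  obtain ⟨d, hd⟩ := (hcode q hq).exists_offset
  refine ⟨d, fun p hp => ?_⟩
  obtain ⟨e, he⟩ := (hcode p hp).exists_offset
  have h1 := length_view_singleton_sub_lt hloc (hSB hq) (hfair p hp)
  have h2 := length_view_singleton_sub_lt hloc (hSB hp) (hfair q hq)
  have h3 := length_view_singleton_sub_lt hloc (hSB hq) (hfair' p hp)
  have h4 := length_view_singleton_sub_lt hloc (hSB hp) (hfair' q hq)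
  have h5 : 2 * (k : ℤ) * (e - d) < 2 * k * 1 := by push_cast [mul_sub]; omega
  have h6 : 2 * (k : ℤ) * (d - e) < 2 * k * 1 := by push_cast [mul_sub]; omega
  have h7 := lt_of_mul_lt_mul_left h5 (by positivity)
  have h8 := lt_of_mul_lt_mul_left h6 (by positivity)
  have h9 : e = d := by omega
  rw [he, h9]

/-- Equality of the levels of the common view of processes with the same codes. -/
theorem level_view_eqv_of_codeEq (hk : 1 ≤ k) {S : Finset P} (hS : S.Nonempty)
    {w w' : List α} {d : ℤ}
    (hd : ∀ p ∈ S, ((view loc {p} w').length : ℤ) = (view loc {p} w).length + 2 * k * d)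
    (hcode : ∀ p ∈ S, CodeEq loc k (view loc {p} w) (view loc {p} w')) {c : ℤ}
    (hc : ∀ p ∈ S, topLevel k (view loc {p} w) - 2 ≤ c) :
    Eqv loc (level loc k (view loc S w) c) (level loc k (view loc S w') (c + 2 * d)) := by
  intro r
  obtain ⟨p, hp, h⟩ := exists_proj_level_view_eq (loc := loc) (k := k) hS r w
  obtain ⟨p', hp', h'⟩ := exists_proj_level_view_eq (loc := loc) (k := k) hS r w'
  have h1 := proj_level_view_isPrefix (loc := loc) (k := k) (Finset.singleton_subset_iff.2 hp) r w'
    (c + 2 * d)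
  have h2 := proj_level_view_isPrefix (loc := loc) (k := k)
    (Finset.singleton_subset_iff.2 hp') r w c
  rw [← (hcode p hp).level_eqv hk (hd p hp) (hc p hp) r, ← h] at h1
  rw [(hcode p' hp').level_eqv hk (hd p' hp') (hc p' hp') r, ← h'] at h2
  exact h1.eq_of_length_le h2.length_le

/-- The events of the common view of `S` outside of the view of `p ∈ S` are determined by the
codes of the views of the processes of `S`. -/
theorem rest_view_eqv_of_codeEq (hloc : ∀ a, (loc a).Nonempty) (hk : 1 ≤ k) {S B : Finset P}
    (hSB : S ⊆ B) {w w' : List α} (hw : ∀ a ∈ w, loc a ⊆ B) (hw' : ∀ a ∈ w', loc a ⊆ B)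
    (hfair : ∀ p ∈ S, Fair loc k B (view loc {p} w))
    (hfair' : ∀ p ∈ S, Fair loc k B (view loc {p} w')) {d : ℤ}
    (hd : ∀ p ∈ S, ((view loc {p} w').length : ℤ) = (view loc {p} w).length + 2 * k * d)
    (hcode : ∀ p ∈ S, CodeEq loc k (view loc {p} w) (view loc {p} w')) {p : P} (hp : p ∈ S) :
    Eqv loc (rest loc {p} (view loc S w)) (rest loc {p} (view loc S w')) := by
  have hpS : {p} ⊆ S := Finset.singleton_subset_iff.2 hp
  have hrest : ∀ w : List α, (∀ a ∈ w, loc a ⊆ B) → Fair loc k B (view loc {p} w) → ∀ c,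
      c < topLevel k (view loc {p} w) - 1 →
      (rest (fun x : α × ℤ => loc x.1) {p} (tag loc k (view loc S w))).filter
        (fun x => decide (x.2 = c)) = [] := by
    intro w hw hf c hc
    rw [List.filter_eq_nil_iff]
    intro x hx
    have h1 := topLevel_le_of_mem_rest_tag hloc hk (S := {p})
      (fun a ha => hw a ((view_sublist S w).mem ha)) (by rwa [view_view_of_subset hpS]) hx
    rw [view_view_of_subset hpS] at h1
    simp only [decide_eq_true_eq]
    omega
  have hlev : ∀ c, Eqv loc
      (((rest (fun x : α × ℤ => loc x.1) {p} (tag loc k (view loc S w))).filter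
        fun x => decide (x.2 = c)).map Prod.fst)
      (((rest (fun x : α × ℤ => loc x.1) {p} (tag loc k (view loc S w'))).filter
        fun x => decide (x.2 = c + 2 * d)).map Prod.fst) := by
    intro c
    rcases lt_or_ge c (topLevel k (view loc {p} w) - 1) with hc | hc
    · rw [hrest w hw (hfair p hp) c hc, hrest w' hw' (hfair' p hp)]
      · exact Eqv.refl _
      · rw [topLevel_eq hk (hd p hp)]
        linarith
    · have h1 := level_view_eqv_of_codeEq hk ⟨p, hp⟩ hd hcode (c := c) fun q hq => by
        have h2 := length_view_singleton_sub_lt hloc (hSB hp) (hfair q hq)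
        have h3 : ((view loc {q} w).length : ℤ) + 1 ≤ (view loc {p} w).length + 1 + 1 * k := by
          omega
        have h4 := Int.ediv_le_ediv (c := k) (by omega) h3
        rw [Int.add_mul_ediv_right _ _ (by omega)] at h4
        simp only [topLevel] at hc ⊢
        linarith
      have h2 := (((level_view_eqv S {p} hpS w c).symm.trans h1).trans
        (level_view_eqv S {p} hpS w' (c + 2 * d)))
      exact h2.append_left_cancel ((hcode p hp).level_eqv hk (hd p hp) (by linarith))
  intro r
  have hsorted : ∀ w : List α, (proj (fun x : α × ℤ => loc x.1) r
      (rest (fun x : α × ℤ => loc x.1) {p} (tag loc k (view loc S w)))).Pairwise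
        fun x y => x.2 ≤ y.2 := fun w =>
    (pairwise_proj_tag hk r (view loc S w)).sublist ((rest_sublist _ _).filter _)
  have h1 := map_fst_eq_of_levels (d := 2 * d) (hsorted w) (hsorted w') fun c => by
    have h2 := hlev c r
    rwa [← map_proj, ← map_proj, proj_filter, proj_filter] at h2
  rwa [map_proj, map_proj, map_rest, map_rest, map_fst_tag, map_fst_tag] at h1

/-- The code of the common view of the processes of a letter, extended by that letter, is
determined by the codes of the views of the processes. -/
theorem codeEq_view_concat (hloc : ∀ a, (loc a).Nonempty) (hk : 1 ≤ k) {B : Finset P}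
    {a : α} (hSB : loc a ⊆ B) {w w' : List α} (hw : ∀ a ∈ w, loc a ⊆ B)
    (hw' : ∀ a ∈ w', loc a ⊆ B)
    (hfair : ∀ p ∈ loc a, Fair loc k B (view loc {p} w))
    (hfair' : ∀ p ∈ loc a, Fair loc k B (view loc {p} w'))
    (hcode : ∀ p ∈ loc a, CodeEq loc k (view loc {p} w) (view loc {p} w')) :
    CodeEq loc k (view loc (loc a) w ++ [a]) (view loc (loc a) w' ++ [a]) := by
  obtain ⟨d, hd⟩ := exists_common_offset hloc (hloc a) hSB hfair hfair' hcode
  have hlen : ((view loc (loc a) w').length : ℤ) = (view loc (loc a) w).length + 2 * k * d := by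
    obtain ⟨p, hp⟩ := hloc a
    have h1 := (rest_view_eqv_of_codeEq hloc hk hSB hw hw' hfair hfair' hd hcode hp).length_eq hloc
    have h2 : ∀ w, (view loc {p} w).length + (rest loc {p} (view loc (loc a) w)).length =
        (view loc (loc a) w).length := fun w => by
      rw [← length_view_add_length_rest {p} (view loc (loc a) w),
        view_view_of_subset (Finset.singleton_subset_iff.2 hp)]
    rw [← h2, ← h2, Nat.cast_add, Nat.cast_add, hd p hp, h1]
    ring
  have hlen' : ((view loc (loc a) w' ++ [a]).length : ℤ) =
      (view loc (loc a) w ++ [a]).length + 2 * k * d := by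
    simp only [List.length_append, List.length_singleton]
    push_cast
    linarith
  refine ⟨by rw [hlen']; simp, fun c hc => ?_⟩
  have h1 : ∀ v c, level loc k (v ++ [a]) c = level loc k v c ++
      if ((view loc (loc a) v).length : ℤ) / k = c then [a] else [] := fun v c => by
    rw [level, tag_concat, List.filter_append, List.map_append]
    split_ifs with h <;> simp [h, level]
  rw [topLevel_eq hk hlen', h1, h1, view_view_of_subset subset_rfl, view_view_of_subset subset_rfl,
    hlen, show topLevel k (view loc (loc a) w ++ [a]) + 2 * d - c =
      topLevel k (view loc (loc a) w ++ [a]) - c + 2 * d by ring,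
    show ((view loc (loc a) w).length : ℤ) + 2 * k * d =
      (view loc (loc a) w).length + 2 * d * k by ring, Int.add_mul_ediv_right _ _ (by omega)]
  refine (level_view_eqv_of_codeEq hk (hloc a) hd hcode fun p hp => ?_).append ?_
  · have h2 := (view_sublist_view (loc := loc) (Finset.singleton_subset_iff.2 hp)
      (List.Sublist.refl w)).length_le
    have h3 : topLevel k (view loc {p} w) ≤ topLevel k (view loc (loc a) w ++ [a]) := by
      simp only [topLevel, List.length_append, List.length_singleton]
      exact Int.ediv_le_ediv (by omega) (by push_cast; omega)
    linarith
  · simp only [add_left_inj]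
    exact Eqv.refl _

end Merge

section Bag

variable [DecidableEq P] (loc : α → Finset P)

/-- The events that only involve processes of `B`. -/
def within (B : Finset P) (w : List α) : List α := w.filter fun a => decide (loc a ⊆ B)

variable {loc} {k : ℕ} {B : Finset P} {o : P}

theorem mem_within {w : List α} {a : α} : a ∈ within loc B w ↔ a ∈ w ∧ loc a ⊆ B := by
  simp [within]

theorem within_append (u v : List α) :
    within loc B (u ++ v) = within loc B u ++ within loc B v := List.filter_append u v

theorem within_singleton_of_subset {a : α} (h : loc a ⊆ B) : within loc B [a] = [a] := by
  simp [within, h]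

theorem within_singleton_of_not_subset {a : α} (h : ¬ loc a ⊆ B) : within loc B [a] = [] := by
  simp [within, h]

/-- If letters leaving `B` meet `B` in `o` only, then views commute with the restriction to `B`. -/
theorem within_view (ho : o ∈ B) (hB : ∀ a, loc a ⊆ B ∨ loc a ∩ B ⊆ {o}) {S : Finset P}
    (hS : S ⊆ B ∨ o ∈ S) (w : List α) :
    within loc B (view loc S w) = view loc (S ∩ B) (within loc B w) := by
  induction w using List.reverseRecOn generalizing S with
  | nil => rfl
  | append_singleton w a ih =>
    rw [within_append]
    by_cases ha : loc a ⊆ B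
    · rw [within_singleton_of_subset ha]
      by_cases h : Disjoint (loc a) S
      · rw [view_concat_of_disjoint h, ih hS,
          view_concat_of_disjoint (h.mono_right Finset.inter_subset_left)]
      · rw [view_concat_of_not_disjoint h, within_append, within_singleton_of_subset ha,
          ih (hS.imp (fun h => Finset.union_subset h ha) fun h => Finset.mem_union_left _ h),
          view_concat_of_not_disjoint, Finset.union_inter_distrib_right,
          Finset.inter_eq_left.2 ha]
        rwa [Finset.inter_comm, Finset.disjoint_iff_inter_eq_empty, ← Finset.inter_assoc,
          Finset.inter_eq_left.2 ha, ← Finset.disjoint_iff_inter_eq_empty]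
    · rw [within_singleton_of_not_subset ha, List.append_nil]
      have haB := (hB a).resolve_left ha
      by_cases h : Disjoint (loc a) S
      · rw [view_concat_of_disjoint h, ih hS]
      · have hoS : o ∈ S := hS.elim (fun hSB => by
          obtain ⟨p, hpa, hpS⟩ := Finset.not_disjoint_iff.1 h
          have h1 := haB (Finset.mem_inter.2 ⟨hpa, hSB hpS⟩)
          rwa [Finset.mem_singleton.1 h1] at hpS) id
        rw [view_concat_of_not_disjoint h, within_append, within_singleton_of_not_subset ha,
          List.append_nil, ih (Or.inr (Finset.mem_union_left _ hoS)),
          Finset.union_inter_distrib_right, Finset.union_eq_left.2]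
        exact haB.trans (Finset.singleton_subset_iff.2 (Finset.mem_inter.2 ⟨hoS, ho⟩))

theorem within_rest_view_eqv (ho : o ∈ B) (hB : ∀ a, loc a ⊆ B ∨ loc a ∩ B ⊆ {o})
    {S : Finset P} (hSB : S ⊆ B) {p : P} (hp : p ∈ S) (w : List α) :
    Eqv loc (within loc B (rest loc {p} (view loc S w)))
      (rest loc {p} (view loc S (within loc B w))) := by
  have hpS : {p} ⊆ S := Finset.singleton_subset_iff.2 hp
  have h1 : Eqv loc (within loc B (view loc S w)) (within loc B (view loc {p} w ++ _)) :=
    (eqv_view_of_subset hpS w).filter _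
  rw [within_append, within_view ho hB (Or.inl hSB), within_view ho hB (Or.inl (hpS.trans hSB)),
    Finset.inter_eq_left.2 hSB, Finset.inter_eq_left.2 (hpS.trans hSB)] at h1
  exact (h1.symm.trans (eqv_view_of_subset hpS _)).append_left_cancel (Eqv.refl _)

/-- Conditions under which all events of the view of `S` outside of the view of `p` only involve
processes of `B`. -/
theorem subset_of_mem_rest_view (hloc : ∀ a, (loc a).Nonempty)
    (hB : ∀ a, loc a ⊆ B ∨ loc a ∩ B ⊆ {o})
    {S : Finset P} (hSB : S ⊆ B) {p : P} (hp : p ∈ S) {w : List α} (hpo : o ∈ S → p = o)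
    (hx : ∀ a ∈ within loc B (rest loc {p} (view loc S w)), o ∉ loc a) {a : α}
    (ha : a ∈ rest loc {p} (view loc S w)) : loc a ⊆ B := by
  by_contra haB
  obtain ⟨y, f, z, hyz, hf, hz⟩ := exists_last (f := fun b => ¬ loc b ⊆ B) ⟨a, ha, haB⟩
  simp only [not_not] at hz
  have hfB := (hB f).resolve_left hf
  have hfz : Eqv loc ([f] ++ z) (z ++ [f]) := by
    intro r
    rw [proj_append, proj_append]
    by_cases hr : r ∈ loc f
    · have : proj loc r z = [] := proj_eq_nil.2 fun b hb hrb => by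
        have h1 := Finset.mem_singleton.1 (hfB (Finset.mem_inter.2 ⟨hr, hz b hb hrb⟩))
        exact hx b (mem_within.2 ⟨by rw [hyz]; simp [hb], hz b hb⟩) (h1 ▸ hrb)
      simp [this]
    · simp [proj_singleton_of_notMem hr]
  have h1 : Eqv loc (view loc S w) ((view loc {p} w ++ y ++ z) ++ [f]) := by
    refine (eqv_view_of_subset (Finset.singleton_subset_iff.2 hp) w).trans ?_
    rw [hyz, List.append_assoc, List.append_assoc]
    exact (Eqv.refl _).append ((Eqv.refl _).append hfz)
  refine not_disjoint_of_eqv_concat hloc h1 (Finset.disjoint_left.2 fun r hrf hrS => ?_)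
  obtain rfl := Finset.mem_singleton.1 (hfB (Finset.mem_inter.2 ⟨hrf, hSB hrS⟩))
  have h2 : f ∈ rest loc {p} (view loc S w) := by rw [hyz]; simp
  exact Finset.disjoint_left.1 (disjoint_of_mem_rest h2) hrf (by simp [hpo hrS])

variable {Q : Type*} {A : DetAut α Q}

/-- The state reached after the common view of processes of a bag is determined by the states
reached after the views of the processes, and by the codes of their views within the bag. -/
theorem run_view_eq_of_codeEq (hloc : ∀ a, (loc a).Nonempty) (hA : A.Diamond loc) (hk : 1 ≤ k)
    (ho : o ∈ B) (hB : ∀ a, loc a ⊆ B ∨ loc a ∩ B ⊆ {o})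
    {S : Finset P} (hS : S.Nonempty) (hSB : S ⊆ B) {w w' : List α}
    (hfair : ∀ p ∈ S, Fair loc k B (view loc {p} (within loc B w)))
    (hfair' : ∀ p ∈ S, Fair loc k B (view loc {p} (within loc B w')))
    (hcode : ∀ p ∈ S, CodeEq loc k (view loc {p} (within loc B w))
      (view loc {p} (within loc B w')))
    (q : Q) (hrun : ∀ p ∈ S, A.run q (view loc {p} w) = A.run q (view loc {p} w')) :
    A.run q (view loc S w) = A.run q (view loc S w') := by
  have hin : ∀ v : List α, ∀ a ∈ within loc B v, loc a ⊆ B := fun v a ha => (mem_within.1 ha).2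
  obtain ⟨d, hd⟩ := exists_common_offset hloc hS hSB hfair hfair' hcode
  have hrest : ∀ p ∈ S, Eqv loc (within loc B (rest loc {p} (view loc S w)))
      (within loc B (rest loc {p} (view loc S w'))) := fun p hp =>
    ((within_rest_view_eqv ho hB hSB hp w).trans (rest_view_eqv_of_codeEq hloc hk hSB (hin w)
      (hin w') hfair hfair' hd hcode hp)).trans (within_rest_view_eqv ho hB hSB hp w').symm
  obtain ⟨p, hp, hpo, hx⟩ : ∃ p ∈ S, (o ∈ S → p = o) ∧
      ∀ a ∈ within loc B (rest loc {p} (view loc S w')), o ∉ loc a := by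
    by_cases hoS : o ∈ S
    · refine ⟨o, hoS, fun _ => rfl, fun a ha hoa => ?_⟩
      exact Finset.disjoint_left.1 (disjoint_of_mem_rest (mem_within.1 ha).1) hoa (by simp)
    · obtain ⟨p, hp, h⟩ := exists_proj_view_eq (loc := loc) hS o (within loc B w')
      refine ⟨p, hp, fun h => absurd h hoS, ?_⟩
      rw [← proj_eq_nil, within_rest_view_eqv ho hB hSB hp w' o]
      rw [eqv_view_of_subset (Finset.singleton_subset_iff.2 hp) _ o, proj_append] at h
      exact List.append_right_eq_self.1 h
  have hx' : ∀ a ∈ within loc B (rest loc {p} (view loc S w)), o ∉ loc a := by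
    rw [← proj_eq_nil, hrest p hp o]
    exact proj_eq_nil.2 hx
  have hself : ∀ v, (∀ a ∈ within loc B (rest loc {p} (view loc S v)), o ∉ loc a) →
      within loc B (rest loc {p} (view loc S v)) = rest loc {p} (view loc S v) := fun v hv =>
    List.filter_eq_self.2 fun a ha =>
      decide_eq_true (subset_of_mem_rest_view hloc hB hSB hp hpo hv ha)
  have hr := hrest p hp
  rw [hself w hx', hself w' hx] at hr
  have hpS : {p} ⊆ S := Finset.singleton_subset_iff.2 hp
  rw [run_eqv hloc hA (eqv_view_of_subset hpS w), run_eqv hloc hA (eqv_view_of_subset hpS w'),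
    run_append, run_append, hrun p hp]
  exact congrArg _ (funext fun q' => run_eqv hloc hA hr q')

end Bag

section Separation

variable [DecidableEq P] {loc : α → Finset P} [Fintype P] {X C W : Finset P} {o o' : P}

/-- The common part of the views on both sides of an edge of the tree. -/
theorem view_compl_view_eq (ho : o ∈ X) (ho' : o' ∉ X)
    (hX : ∀ a, loc a ⊆ X ∨ Disjoint (loc a) X ∨ loc a = {o, o'})
    (hC : C ⊆ X) (hoC : o ∈ C) (hW : Disjoint W X) (hoW : o' ∈ W) (w : List α) :
    view loc Xᶜ (view loc C w) = view loc X (view loc W w) := by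
  induction w using List.reverseRecOn generalizing C W with
  | nil => rfl
  | append_singleton w a ih =>
    rcases hX a with ha | ha | ha
    · rw [view_concat_of_disjoint (hW.symm.mono_left ha)]
      by_cases h : Disjoint (loc a) C
      · rw [view_concat_of_disjoint h, ih hC hoC hW hoW]
      · rw [view_concat_of_not_disjoint h,
          view_concat_of_disjoint (disjoint_compl_right_iff.2 ha),
          ih (Finset.union_subset hC ha) (Finset.mem_union_left _ hoC) hW hoW]
    · rw [view_concat_of_disjoint (ha.mono_right hC)]
      by_cases h : Disjoint (loc a) W
      · rw [view_concat_of_disjoint h, ih hC hoC hW hoW]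
      · rw [view_concat_of_not_disjoint h, view_concat_of_disjoint ha,
          ih hC hoC (Finset.disjoint_union_left.2 ⟨hW, ha⟩) (Finset.mem_union_left _ hoW)]
    · have hoa : o ∈ loc a := by simp [ha]
      have hoa' : o' ∈ loc a := by simp [ha]
      rw [view_concat_of_not_disjoint (Finset.not_disjoint_iff.2 ⟨o, hoa, hoC⟩),
        view_concat_of_not_disjoint (Finset.not_disjoint_iff.2 ⟨o', hoa', hoW⟩),
        view_concat_of_not_disjoint (Finset.not_disjoint_iff.2 ⟨o', hoa', by simpa⟩),
        view_concat_of_not_disjoint (Finset.not_disjoint_iff.2 ⟨o, hoa, ho⟩), ha]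
      have h1 : Xᶜ ∪ {o, o'} = Xᶜ ∪ {o} := by ext r; simp; grind
      have h2 : X ∪ {o, o'} = X ∪ {o'} := by ext r; simp; grind
      have h3 : (Xᶜ ∪ {o}) ∩ (X ∪ {o'}) = {o, o'} := by ext r; simp; grind
      have hW' : W ⊆ Xᶜ := by
        rwa [← disjoint_compl_right_iff, compl_compl]
      have h4 : C ∪ {o, o'} ⊆ X ∪ {o'} := by
        rw [← h2]; exact Finset.union_subset_union_left hC
      have h5 : W ∪ {o, o'} ⊆ Xᶜ ∪ {o} := by
        rw [← h1]; exact Finset.union_subset_union_left hW'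
      have hsep : ∀ b ∈ w, loc b ⊆ Xᶜ ∪ {o} ∨ loc b ⊆ X ∪ {o'} := fun b _ => by
        rcases hX b with hb | hb | hb
        · exact Or.inr (hb.trans Finset.subset_union_left)
        · refine Or.inl (Finset.Subset.trans ?_ Finset.subset_union_left)
          rwa [← disjoint_compl_right_iff, compl_compl]
        · rw [hb, ← h3]
          exact Or.inl Finset.inter_subset_left
      rw [h1, h2, view_view_of_separated w hsep subset_rfl h4 Finset.inter_subset_left
        (h3 ▸ Finset.subset_union_right), view_view_of_separated w (fun b hb => (hsep b hb).symm)
        subset_rfl h5 Finset.inter_subset_left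
        (Finset.inter_comm _ (Xᶜ ∪ {o}) ▸ h3 ▸ Finset.subset_union_right), Finset.inter_comm]

theorem eqv_view_union (ho : o ∈ X) (ho' : o' ∉ X)
    (hX : ∀ a, loc a ⊆ X ∨ Disjoint (loc a) X ∨ loc a = {o, o'})
    (hC : C ⊆ X) (hoC : o ∈ C) (hW : Disjoint W X) (hoW : o' ∈ W) (w : List α) :
    Eqv loc (view loc (W ∪ C) w) (view loc Xᶜ (view loc C w) ++
      (rest loc Xᶜ (view loc C w) ++ rest loc X (view loc W w))) := by
  intro r
  have hCr := eqv_view_append_rest (loc := loc) Xᶜ (view loc C w) r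
  have hWr := eqv_view_append_rest (loc := loc) X (view loc W w) r
  rw [← view_compl_view_eq ho ho' hX hC hoC hW hoW] at hWr
  have hC' := proj_view_isPrefix (loc := loc) (S := W ∪ C) (Finset.subset_union_right : C ⊆ _) r w
  have hW' := proj_view_isPrefix (loc := loc) (S := W ∪ C) (Finset.subset_union_left : W ⊆ _) r w
  rw [proj_append] at hCr hWr
  rw [proj_append, proj_append]
  by_cases hr : r ∈ X
  · have h1 : proj loc r (rest loc X (view loc W w)) = [] := proj_eq_nil.2 fun a ha hra =>
      Finset.disjoint_left.1 (disjoint_of_mem_rest ha) hra hr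
    rw [h1, List.append_nil, ← hCr]
    rw [h1, List.append_nil] at hWr
    rcases proj_view_union W C r w with h | h
    · refine (hC'.eq_of_length_le ?_).symm
      rw [h, hWr, hCr, List.length_append]
      omega
    · exact h
  · have h1 : proj loc r (rest loc Xᶜ (view loc C w)) = [] := proj_eq_nil.2 fun a ha hra =>
      Finset.disjoint_left.1 (disjoint_of_mem_rest ha) hra (by simpa)
    rw [h1, List.nil_append, ← hWr]
    rw [h1, List.append_nil] at hCr
    rcases proj_view_union W C r w with h | h
    · exact h
    · refine (hW'.eq_of_length_le ?_).symm
      rw [h, hWr, hCr, List.length_append]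
      omega

variable {Q : Type*} {A : DetAut α Q}

/-- The state reached after the common view of processes on both sides of an edge of the tree is
determined by the states reached after the two views and after their common part. -/
theorem run_view_union_eq (hloc : ∀ a, (loc a).Nonempty) (hA : A.Diamond loc)
    (ho : o ∈ X) (ho' : o' ∉ X) (hX : ∀ a, loc a ⊆ X ∨ Disjoint (loc a) X ∨ loc a = {o, o'})
    (hC : C ⊆ X) (hoC : o ∈ C) (hW : Disjoint W X) (hoW : o' ∈ W) {w w' : List α} {q₀ q : Q}
    (hCrun : A.run q₀ (view loc C w) = A.run q₀ (view loc C w'))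
    (hWrun : A.run q₀ (view loc W w) = A.run q₀ (view loc W w'))
    (hErun : A.run q₀ (view loc Xᶜ (view loc C w)) = A.run q₀ (view loc Xᶜ (view loc C w')))
    (h : A.run q₀ (view loc (W ∪ C) w') = some q) : A.run q₀ (view loc (W ∪ C) w) = some q := by
  have hCr := fun w => eqv_view_append_rest (loc := loc) Xᶜ (view loc C w)
  have hWr := fun w => eqv_view_append_rest (loc := loc) X (view loc W w)
  simp only [← view_compl_view_eq ho ho' hX hC hoC hW hoW] at hWr
  have hU := fun w => eqv_view_union ho ho' hX hC hoC hW hoW (loc := loc) w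
  have hdisj : ∀ w w', ∀ a ∈ rest loc Xᶜ (view loc C w), ∀ b ∈ rest loc X (view loc W w'),
      Disjoint (loc a) (loc b) := fun w w' a ha b hb =>
    ((disjoint_of_mem_rest hb).mono_right
      (disjoint_compl_right_iff.1 (disjoint_of_mem_rest ha))).symm
  rw [run_eqv hloc hA (hU w')] at h
  rw [run_eqv hloc hA (hU w)]
  rw [run_eqv hloc hA (hCr w), run_eqv hloc hA (hCr w'), run_append, run_append, hErun] at hCrun
  rw [run_eqv hloc hA (hWr w), run_eqv hloc hA (hWr w'), run_append, run_append, hErun] at hWrun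
  rw [run_append] at h ⊢
  rw [hErun]
  obtain ⟨qE, hqE, h⟩ := Option.bind_eq_some_iff.1 h
  rw [hqE] at hCrun hWrun ⊢
  simp only [Option.bind_some] at hCrun hWrun ⊢
  have h' := h
  rw [run_append] at h'
  obtain ⟨qx, hqx, -⟩ := Option.bind_eq_some_iff.1 h'
  have hcomm : A.run qE (rest loc X (view loc W w') ++ rest loc Xᶜ (view loc C w')) = some q := by
    rw [← h]
    refine run_eqv hloc hA (fun r => ?_) qE
    rw [proj_append, proj_append]
    by_cases hr : r ∈ X
    · have h1 : proj loc r (rest loc X (view loc W w')) = [] := proj_eq_nil.2 fun a ha hra =>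
        Finset.disjoint_left.1 (disjoint_of_mem_rest ha) hra hr
      simp [h1]
    · have h1 : proj loc r (rest loc Xᶜ (view loc C w')) = [] := proj_eq_nil.2 fun a ha hra =>
        Finset.disjoint_left.1 (disjoint_of_mem_rest ha) hra (by simpa)
      simp [h1]
  rw [run_append] at hcomm
  obtain ⟨qy, hqy, -⟩ := Option.bind_eq_some_iff.1 hcomm
  exact run_append_eq_of_run_eq hloc hA (hdisj w' w) (hdisj w' w') (hCrun.trans hqx) hqx
    (hWrun.trans hqy) hqy h

end Separation

section Architecture

/-- In a tree, every vertex has at most one neighbour closer to a given root. -/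
theorem eq_of_adj_of_dist {V : Type*} {G : SimpleGraph V} (hG : G.IsTree) {r c d e : V}
    (hd : G.Adj d c) (he : G.Adj e c) (hdc : G.dist r c = G.dist r d + 1)
    (hec : G.dist r c = G.dist r e + 1) : d = e := by
  obtain ⟨p, hp⟩ := (hG.connected.preconnected r d).exists_walk_length_eq_dist
  obtain ⟨q, hq⟩ := (hG.connected.preconnected r e).exists_walk_length_eq_dist
  have h1 : (p.concat hd).IsPath :=
    SimpleGraph.Walk.isPath_of_length_eq_dist _ (by rw [SimpleGraph.Walk.length_concat, hp, hdc])
  have h2 : (q.concat he).IsPath :=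
    SimpleGraph.Walk.isPath_of_length_eq_dist _ (by rw [SimpleGraph.Walk.length_concat, hq, hec])
  have h3 := congrArg Subtype.val ((hG.isAcyclic.subsingleton_path r c).elim ⟨_, h1⟩ ⟨_, h2⟩)
  have h4 := congrArg SimpleGraph.Walk.penultimate h3
  simpa using h4

variable [DecidableEq P] {ι : Type*} {loc : α → Finset P} {bag : P → ι} {out : ι → P}

/-- A rooted form of the tree of bags. -/
theorem exists_parent
    (hinner : ∀ (a : α) (p : P), p ∈ loc a → p ≠ out (bag p) → ∀ q ∈ loc a, bag q = bag p)
    (htree : (commGraphOuter loc out).IsTree) :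
    ∃ (root : ι) (par : ι → ι) (dep : ι → ℕ), par root = root ∧
      (∀ c, c ≠ root → dep (par c) < dep c) ∧
      ∀ a, (∃ j, ∀ p ∈ loc a, bag p = j) ∨ ∃ c, c ≠ root ∧ loc a = {out c, out (par c)} := by
  classical
  obtain ⟨root⟩ := htree.connected.nonempty
  set G := commGraphOuter loc out
  have hex : ∀ c, c ≠ root → ∃ d, G.Adj d c ∧ G.dist root c = G.dist root d + 1 := by
    intro c hc
    obtain ⟨p, hp⟩ := (htree.connected.preconnected root c).exists_walk_length_eq_dist
    have hnil : ¬ p.Nil := SimpleGraph.Walk.not_nil_of_ne hc.symm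
    refine ⟨p.penultimate, p.adj_penultimate hnil, le_antisymm ?_ ?_⟩
    · have h := htree.connected.dist_triangle (u := root) (v := p.penultimate) (w := c)
      rwa [SimpleGraph.dist_eq_one_iff_adj.2 (p.adj_penultimate hnil)] at h
    · have h1 := SimpleGraph.dist_le p.dropLast
      have h2 : p.dropLast.length + 1 = p.length := by
        conv_rhs => rw [← p.concat_dropLast (p.adj_penultimate hnil)]
        rw [SimpleGraph.Walk.length_concat]
      omega
  choose! f hf hfd using hex
  refine ⟨root, fun c => if c = root then root else f c, G.dist root, by simp,
    fun c hc => by simp [hc, hfd c hc], fun a => ?_⟩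
  have hadj : ∀ c d, c ≠ d → out c ∈ loc a → out d ∈ loc a →
      (c ≠ root ∧ d = f c) ∨ (d ≠ root ∧ c = f d) := by
    intro c d hcd hc hd
    have h : G.Adj c d := ⟨hcd, a, hc, hd⟩
    rcases htree.dist_eq_dist_add_one_of_adj root h with h1 | h1
    · have hroot : c ≠ root := by rintro rfl; simp at h1
      exact Or.inl ⟨hroot, eq_of_adj_of_dist htree h.symm (hf c hroot) h1 (hfd c hroot)⟩
    · have hroot : d ≠ root := by rintro rfl; simp at h1
      exact Or.inr ⟨hroot, eq_of_adj_of_dist htree h (hf d hroot) h1 (hfd d hroot)⟩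
  by_cases hbag : ∃ j, ∀ p ∈ loc a, bag p = j
  · exact Or.inl hbag
  right
  have houter : ∀ p ∈ loc a, out (bag p) = p := fun p hp => by
    by_contra h
    exact hbag ⟨_, hinner a p hp (Ne.symm h)⟩
  have hpair : ∃ c, c ≠ root ∧ out c ∈ loc a ∧ out (f c) ∈ loc a := by
    push Not at hbag
    have hne : (loc a).Nonempty := by
      obtain ⟨p, hp, -⟩ := hbag root
      exact ⟨p, hp⟩
    obtain ⟨p, hp⟩ := hne
    obtain ⟨q, hq, hqp⟩ := hbag (bag p)
    have hp' := houter p hp ▸ hp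
    have hq' := houter q hq ▸ hq
    rcases hadj _ _ hqp hq' hp' with ⟨h1, h2⟩ | ⟨h1, h2⟩
    · exact ⟨_, h1, hq', h2 ▸ hp'⟩
    · exact ⟨_, h1, hp', h2 ▸ hq'⟩
  obtain ⟨c, hc, hca, hfa⟩ := hpair
  refine ⟨c, hc, ?_⟩
  simp only [if_neg hc]
  refine Finset.Subset.antisymm (fun r hr => ?_) (Finset.insert_subset_iff.2
    ⟨hca, Finset.singleton_subset_iff.2 hfa⟩)
  have hr' := houter r hr ▸ hr
  by_contra hrc
  simp only [Finset.mem_insert, Finset.mem_singleton, not_or] at hrc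
  have h1 : bag r ≠ c := fun h => hrc.1 (h ▸ (houter r hr).symm)
  have h2 : bag r ≠ f c := fun h => hrc.2 (h ▸ (houter r hr).symm)
  have h3 := hfd c hc
  rcases hadj _ _ h1 hr' hca with ⟨h4, h5⟩ | ⟨-, h5⟩
  · have h6 := hfd _ h4
    rcases hadj _ _ h2 hr' hfa with ⟨-, h7⟩ | ⟨h7, h8⟩
    · rw [← h5] at h7
      rw [h7] at h3
      omega
    · have h9 := hfd _ h7
      rw [← h5] at h6
      rw [← h8] at h9
      omega
  · exact h2 h5

end Architecture

section Subtree

variable [Fintype P] {ι : Type*} (bag : P → ι)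
  (par : ι → ι)

open Classical in
/-- The processes of the subtree below a bag. -/
noncomputable def subtree (c : ι) : Finset P :=
  Finset.univ.filter fun p => ∃ m, par^[m] (bag p) = c

variable {bag par} {out : ι → P} {root : ι} {dep : ι → ℕ}

theorem mem_subtree {c : ι} {p : P} : p ∈ subtree bag par c ↔ ∃ m, par^[m] (bag p) = c := by
  simp [subtree]

theorem dep_iterate_le (hroot : par root = root) (hdep : ∀ c, c ≠ root → dep (par c) < dep c)
    (m : ℕ) (c : ι) : dep (par^[m] c) ≤ dep c := by
  induction m generalizing c with
  | zero => exact le_rfl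
  | succ m ih =>
    refine (ih (par c)).trans ?_
    by_cases h : c = root
    · rw [h, hroot]
    · exact (hdep c h).le

theorem mem_subtree_self (hout : ∀ j, bag (out j) = j) (c : ι) :
    out c ∈ subtree bag par c := mem_subtree.2 ⟨0, hout c⟩

theorem eq_of_mem_subtree (hroot : par root = root)
    (hdep : ∀ c, c ≠ root → dep (par c) < dep c) {c : ι} {p : P} (h : p ∈ subtree bag par c)
    (hle : dep (bag p) ≤ dep c) : bag p = c := by
  obtain ⟨m, rfl⟩ := mem_subtree.1 h
  cases m with
  | zero => rfl
  | succ m =>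
    by_cases hp : bag p = root
    · rw [hp, Function.iterate_fixed hroot]
    · have h1 := dep_iterate_le hroot hdep m (par (bag p))
      have h2 := hdep _ hp
      rw [Function.iterate_succ_apply] at hle
      omega

theorem out_parent_notMem_subtree (hout : ∀ j, bag (out j) = j) (hroot : par root = root)
    (hdep : ∀ c, c ≠ root → dep (par c) < dep c) {c : ι} (hc : c ≠ root) :
    out (par c) ∉ subtree bag par c := fun h => by
  have h1 := eq_of_mem_subtree hroot hdep h (by rw [hout]; exact (hdep c hc).le)
  have h2 := hdep c hc
  rw [hout] at h1
  rw [h1] at h2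
  omega

theorem subtree_root (hdep : ∀ c, c ≠ root → dep (par c) < dep c) :
    subtree bag par root = Finset.univ := by
  have key : ∀ n c, dep c = n → ∃ m, par^[m] c = root := by
    intro n
    induction n using Nat.strong_induction_on with
    | _ n ih =>
      rintro c rfl
      by_cases hc : c = root
      · exact ⟨0, hc⟩
      · obtain ⟨m, hm⟩ := ih _ (hdep c hc) _ rfl
        exact ⟨m + 1, hm⟩
  ext p
  simpa only [mem_subtree, Finset.mem_univ, iff_true] using key _ (bag p) rfl

variable [DecidableEq P] {loc : α → Finset P}

theorem subset_subtree_or (hout : ∀ j, bag (out j) = j)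
    (hletter : ∀ a, (∃ j, ∀ p ∈ loc a, bag p = j) ∨
      ∃ c, c ≠ root ∧ loc a = {out c, out (par c)}) (c : ι) (a : α) :
    loc a ⊆ subtree bag par c ∨ Disjoint (loc a) (subtree bag par c) ∨
      loc a = {out c, out (par c)} := by
  have key : ∀ s : Finset P, (∀ p ∈ s, ∀ q ∈ s, p ∈ subtree bag par c → q ∈ subtree bag par c) →
      s ⊆ subtree bag par c ∨ Disjoint s (subtree bag par c) := fun s hs => by
    by_cases h : Disjoint s (subtree bag par c)
    · exact Or.inr h
    · obtain ⟨p, hp, hpc⟩ := Finset.not_disjoint_iff.1 h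
      exact Or.inl fun q hq => hs p hp q hq hpc
  rcases hletter a with ⟨j, hj⟩ | ⟨d, -, hd⟩
  · refine (key _ fun p hp q hq => ?_).imp id Or.inl
    rw [mem_subtree, mem_subtree, hj p hp, hj q hq]
    exact id
  · by_cases hdc : d = c
    · exact Or.inr (Or.inr (hdc ▸ hd))
    refine (key _ fun p hp q hq hpc => ?_).imp id Or.inl
    have h1 : out d ∈ subtree bag par c ↔ out (par d) ∈ subtree bag par c := by
      rw [mem_subtree, mem_subtree, hout, hout]
      constructor
      · rintro ⟨m, hm⟩
        cases m with
        | zero => exact absurd hm hdc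
        | succ m => exact ⟨m, hm⟩
      · rintro ⟨m, hm⟩
        exact ⟨m + 1, hm⟩
    have h2 : ∀ r ∈ loc a, r ∈ subtree bag par c ↔ out d ∈ subtree bag par c := fun r hr => by
      rw [hd, Finset.mem_insert, Finset.mem_singleton] at hr
      rcases hr with rfl | rfl
      · exact Iff.rfl
      · exact h1.symm
    exact (h2 q hq).2 ((h2 p hp).1 hpc)

end Subtree

section Code

variable [DecidableEq P] (loc : α → Finset P) (k : ℕ)

/-- A representative of the trace of a word. -/
noncomputable def canon (u : List α) : List α :=
  @Classical.epsilon _ ⟨u⟩ fun v => Eqv loc u v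

/-- The three topmost levels of a word, up to equivalence. -/
noncomputable def topWord (w : List α) : List (Option α) :=
  (canon loc (level loc k w (topLevel k w - 2))).map some ++ none ::
    ((canon loc (level loc k w (topLevel k w - 1))).map some ++ none ::
      (canon loc (level loc k w (topLevel k w))).map some)

variable {loc k}

theorem eqv_canon (u : List α) : Eqv loc u (canon loc u) :=
  Classical.epsilon_spec (p := fun v => Eqv loc u v) ⟨u, Eqv.refl u⟩

theorem canon_eq_iff {u v : List α} : canon loc u = canon loc v ↔ Eqv loc u v := by
  constructor
  · intro h
    exact (eqv_canon u).trans (h ▸ (eqv_canon v).symm)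
  · intro h
    have h1 : (fun x => Eqv loc u x) = fun x => Eqv loc v x :=
      funext fun x => propext ⟨fun h' => h.symm.trans h', fun h' => h.trans h'⟩
    simp only [canon, h1]

theorem map_some_append_none_inj {u u' : List α} {v v' : List (Option α)}
    (h : u.map some ++ none :: v = u'.map some ++ none :: v') : u = u' ∧ v = v' := by
  induction u generalizing u' with
  | nil =>
    cases u' with
    | nil => simpa using h
    | cons b u' => simp at h
  | cons a u ih =>
    cases u' with
    | nil => simp at h
    | cons b u' =>
      simp only [List.map_cons, List.cons_append, List.cons.injEq, Option.some.injEq] at h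
      obtain ⟨rfl, h⟩ := h
      obtain ⟨rfl, rfl⟩ := ih h
      exact ⟨rfl, rfl⟩

theorem level_eq_nil_of_topLevel_lt (hk : 1 ≤ k) {w : List α} {c : ℤ} (hc : topLevel k w < c) :
    level loc k w c = [] := by
  rw [level, List.map_eq_nil_iff, List.filter_eq_nil_iff]
  rintro ⟨a, d⟩ hd
  have h1 := (tag_bounds hk hd).2
  have h2 : d ≤ topLevel k w := (Int.le_ediv_iff_mul_le (by omega)).2 (by linarith)
  simp only [decide_eq_true_eq]
  omega

theorem topWord_eq_iff (hk : 1 ≤ k) {w w' : List α} : topWord loc k w = topWord loc k w' ↔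
    ∀ d ≤ 2, Eqv loc (level loc k w (topLevel k w - d)) (level loc k w' (topLevel k w' - d)) := by
  constructor
  · intro h d hd
    obtain ⟨h2, h⟩ := map_some_append_none_inj h
    obtain ⟨h1, h⟩ := map_some_append_none_inj h
    have h0 := List.map_injective_iff.2 (Option.some_injective α) h
    rw [canon_eq_iff] at h0 h1 h2
    rcases lt_or_ge d 0 with hd0 | hd0
    · rw [level_eq_nil_of_topLevel_lt hk (by omega), level_eq_nil_of_topLevel_lt hk (by omega)]
      exact Eqv.refl _
    · interval_cases d
      · simpa using h0
      · exact h1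
      · exact h2
  · intro h
    have h0 := canon_eq_iff.2 (h 0 (by norm_num))
    simp only [topWord, canon_eq_iff.2 (h 2 le_rfl), canon_eq_iff.2 (h 1 (by norm_num))]
    rw [sub_zero, sub_zero] at h0
    rw [h0]

theorem length_topWord_le (hloc : ∀ a, (loc a).Nonempty) (hk : 1 ≤ k) (w : List α) :
    (topWord loc k w).length ≤ 3 * k := by
  have hsum : ∀ (l : List (α × ℤ)) (c : ℤ), (l.filter fun x => decide (x.2 = c - 2)).length +
      (l.filter fun x => decide (x.2 = c - 1)).length +
      (l.filter fun x => decide (x.2 = c)).length ≤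
        (l.filter fun x => decide (c - 2 ≤ x.2)).length := by
    intro l c
    induction l with
    | nil => simp
    | cons x l ih =>
      simp only [List.filter_cons, decide_eq_true_eq, apply_ite List.length, List.length_cons]
      split_ifs <;> omega
  have h1 := hsum (tag loc k w) (topLevel k w)
  have h2 := length_filter_le_tag (loc := loc) hk w (topLevel k w - 2)
  have h3 : (w.length : ℤ) + 1 < (topLevel k w + 1) * k :=
    Int.lt_ediv_add_one_mul_self _ (by omega)
  have hlen : ∀ u, (canon loc u).length = u.length := fun u =>
    ((eqv_canon (loc := loc) u).length_eq hloc).symm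
  have h4 : (w.length : ℤ) - (topLevel k w - 2) * k ≤ 3 * k - 2 := by linarith
  have h5 : max 0 ((w.length : ℤ) - (topLevel k w - 2) * k) ≤ 3 * k - 2 :=
    max_le (by omega) h4
  simp only [topWord, List.length_append, List.length_cons, List.length_map, hlen, level]
  omega

/-- The local state coding a word of a bag together with two states of the automaton. -/
noncomputable def code {Q : Type*} (loc : α → Finset P) (hk : 1 ≤ k) (w : List α) (q q' : Q) :
    Fin (2 * k) × Q × Q × (Fin (3 * k) → Option (Option α)) :=
  (⟨w.length % (2 * k), Nat.mod_lt _ (by omega)⟩, q, q', fun i => (topWord loc k w)[(i : ℕ)]?)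

theorem code_eq_iff {Q : Type*} (hloc : ∀ a, (loc a).Nonempty) (hk : 1 ≤ k) {w w' : List α}
    {q₁ q₂ q₁' q₂' : Q} : code loc hk w q₁ q₂ = code loc hk w' q₁' q₂' ↔
      CodeEq loc k w w' ∧ q₁ = q₁' ∧ q₂ = q₂' := by
  have hpad : (fun i : Fin (3 * k) => (topWord loc k w)[(i : ℕ)]?) =
      (fun i : Fin (3 * k) => (topWord loc k w')[(i : ℕ)]?) ↔
        topWord loc k w = topWord loc k w' := by
    refine ⟨fun h => List.ext_getElem? fun i => ?_, fun h => by rw [h]⟩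
    by_cases hi : i < 3 * k
    · exact congrFun h ⟨i, hi⟩
    · rw [List.getElem?_eq_none ((length_topWord_le hloc hk w).trans (not_lt.1 hi)),
        List.getElem?_eq_none ((length_topWord_le hloc hk w').trans (not_lt.1 hi))]
  have hmod : w.length % (2 * k) = w'.length % (2 * k) ↔
      (w.length : ℤ) % (2 * k) = (w'.length : ℤ) % (2 * k) := by
    rw [← Int.natCast_inj]
    push_cast
    rfl
  simp only [code, Prod.mk.injEq, Fin.mk.injEq, hpad, topWord_eq_iff hk, CodeEq, hmod]
  tauto

theorem code_ne {Q : Type*} (hk : 1 ≤ k) {w : List α} {q q' : Q}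
    {x : Fin (2 * k) × Q × Q} : code loc hk w q q' ≠ (x.1, x.2.1, x.2.2, fun _ => none) := by
  intro h
  have h1 := congrFun (congrArg (fun y => y.2.2.2) h) ⟨0, by omega⟩
  simp [code, topWord] at h1

end Code

section Feasible

variable {Q : Type*} (A : DetAut α Q)

/-- The word is a prefix of an accepted word. -/
def Feasible (w : List α) : Prop := ∃ v, w ++ v ∈ A.lang

variable {A}

theorem Feasible.exists_run {w : List α} (h : Feasible A w) : ∃ q, A.run A.init w = some q := by
  obtain ⟨v, q, -, hq⟩ := h
  rw [run_append, Option.bind_eq_some_iff] at hq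
  exact ⟨_, hq.choose_spec.1⟩

variable [DecidableEq P] {loc : α → Finset P}

theorem Feasible.of_eqv_append (hloc : ∀ a, (loc a).Nonempty) (hA : A.Diamond loc)
    {w u v : List α} (h : Feasible A w) (hw : Eqv loc w (u ++ v)) : Feasible A u := by
  obtain ⟨x, q, hq, hx⟩ := h
  refine ⟨v ++ x, q, hq, ?_⟩
  rw [← hx, ← List.append_assoc]
  exact run_eqv hloc hA (hw.symm.append (Eqv.refl x)) _

theorem Feasible.view (hloc : ∀ a, (loc a).Nonempty) (hA : A.Diamond loc) {w : List α}
    (h : Feasible A w) (S : Finset P) : Feasible A (view loc S w) :=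
  h.of_eqv_append hloc hA (eqv_view_append_rest S w)

theorem Feasible.view_of_subset (hloc : ∀ a, (loc a).Nonempty) (hA : A.Diamond loc)
    {S T : Finset P} (hTS : T ⊆ S) {w : List α}
    (h : Feasible A (DistTrace.view loc S w)) : Feasible A (DistTrace.view loc T w) :=
  h.of_eqv_append hloc hA (eqv_view_of_subset hTS w)

theorem Feasible.of_run_eq {w w' v : List α} (h : Feasible A (w' ++ v))
    (hrun : A.run A.init w = A.run A.init w') : Feasible A (w ++ v) := by
  obtain ⟨x, q, hq, hx⟩ := h
  refine ⟨x, q, hq, ?_⟩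
  rw [List.append_assoc, run_append] at hx ⊢
  rw [hrun, hx]

theorem mem_locWord {w : List α} {p : P} : p ∈ locWord loc w ↔ ∃ a ∈ w, p ∈ loc a := by
  induction w with
  | nil => simp [locWord]
  | cons a w ih =>
    rw [show locWord loc (a :: w) = loc a ∪ locWord loc w from rfl, Finset.mem_union, ih]
    simp

end Feasible

section LocalState

variable [Fintype P] {ι Q : Type*} [DecidableEq ι]

/-- The processes of a bag. -/
def procs (bag : P → ι) (j : ι) : Finset P := Finset.univ.filter fun p => bag p = j

theorem mem_procs {bag : P → ι} {p : P} {j : ι} : p ∈ procs bag j ↔ bag p = j := by simp [procs]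

theorem procs_subset_subtree {bag : P → ι} {par : ι → ι} (c : ι) :
    procs bag c ⊆ subtree bag par c :=
  fun _ hp => mem_subtree.2 ⟨0, (mem_procs.1 hp :)⟩

variable [DecidableEq P] (A : DetAut α Q) (loc : α → Finset P) {k : ℕ} (hk : 1 ≤ k)
  (bag : P → ι) (out : ι → P) (par : ι → ι)

/-- The events in the view of an outer process that happened outside of its subtree, and their
causal past. -/
noncomputable def outside (w : List α) (p : P) : List α :=
  view loc (subtree bag par (bag p))ᶜ (view loc {p} w)

open Classical in
/-- The local state of a process after a word. -/
noncomputable def localState (w : List α) (p : P) :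
    Fin (2 * k) × Q × Q × (Fin (3 * k) → Option (Option α)) :=
  if Feasible A (view loc {p} w) then
    code loc hk (within loc (procs bag (bag p)) (view loc {p} w))
      ((A.run A.init (view loc {p} w)).getD A.init)
      (if p = out (bag p) then (A.run A.init (outside loc bag par w p)).getD A.init else A.init)
  else (⟨0, by omega⟩, A.init, A.init, fun _ => none)

variable (k)

/-- Both views of `p` are feasible and give rise to the same local state. -/
structure SameState (w w' : List α) (p : P) : Prop where
  feasible : Feasible A (view loc {p} w)
  feasible' : Feasible A (view loc {p} w')
  run_eq : A.run A.init (view loc {p} w) = A.run A.init (view loc {p} w')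
  run_outside_eq : p = out (bag p) →
    A.run A.init (outside loc bag par w p) = A.run A.init (outside loc bag par w' p)
  codeEq : CodeEq loc k (within loc (procs bag (bag p)) (view loc {p} w))
    (within loc (procs bag (bag p)) (view loc {p} w'))

variable {A loc k bag out par}

theorem SameState.localState_eq (hloc : ∀ a, (loc a).Nonempty) {w w' : List α} {p : P}
    (h : SameState A loc k bag out par w w' p) :
    localState A loc hk bag out par w p = localState A loc hk bag out par w' p := by
  rw [localState, localState, if_pos h.feasible, if_pos h.feasible', code_eq_iff hloc, h.run_eq]
  refine ⟨h.codeEq, rfl, ?_⟩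
  split_ifs with hp
  · rw [h.run_outside_eq hp]
  · rfl

theorem sameState_of_localState_eq (hloc : ∀ a, (loc a).Nonempty) (hA : A.Diamond loc)
    {w w' : List α} {p : P} (hf' : Feasible A (view loc {p} w'))
    (h : localState A loc hk bag out par w p = localState A loc hk bag out par w' p) :
    SameState A loc k bag out par w w' p := by
  have hf : Feasible A (view loc {p} w) := by
    by_contra hf
    rw [localState, if_neg hf, localState, if_pos hf'] at h
    exact code_ne hk (x := (⟨0, by omega⟩, A.init, A.init)) h.symm
  rw [localState, localState, if_pos hf, if_pos hf', code_eq_iff hloc] at h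
  have hget : ∀ {u u' : List α}, Feasible A u → Feasible A u' →
      (A.run A.init u).getD A.init = (A.run A.init u').getD A.init →
        A.run A.init u = A.run A.init u' := fun {u u'} hu hu' h => by
    obtain ⟨q, hq⟩ := hu.exists_run
    obtain ⟨q', hq'⟩ := hu'.exists_run
    simpa [hq, hq'] using h
  refine ⟨hf, hf', hget hf hf' h.2.1, fun hp => ?_, h.1⟩
  have h1 := h.2.2
  rw [if_pos hp, if_pos hp] at h1
  exact hget (hf.view hloc hA _) (hf'.view hloc hA _) h1

end LocalState

section Tree

variable [DecidableEq P] [Fintype P] {ι Q : Type*} [DecidableEq ι]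

/-- Every letter is local to a bag or connects the outer process of a bag with the outer process
of the parent bag. -/
structure IsRooted (loc : α → Finset P) (bag : P → ι) (out : ι → P) (root : ι) (par : ι → ι)
    (dep : ι → ℕ) : Prop where
  bag_out : ∀ j, bag (out j) = j
  par_root : par root = root
  dep_par : ∀ c, c ≠ root → dep (par c) < dep c
  letter : ∀ a, (∃ j, ∀ p ∈ loc a, bag p = j) ∨ ∃ c, c ≠ root ∧ loc a = {out c, out (par c)}

variable {A : DetAut α Q} {loc : α → Finset P} {k : ℕ} {bag : P → ι} {out : ι → P} {root : ι}
  {par : ι → ι} {dep : ι → ℕ}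

theorem IsRooted.out_mem_procs (hT : IsRooted loc bag out root par dep) (j : ι) :
    out j ∈ procs bag j := mem_procs.2 (hT.bag_out j)

theorem IsRooted.subset_procs_or (hT : IsRooted loc bag out root par dep) (j : ι) (a : α) :
    loc a ⊆ procs bag j ∨ loc a ∩ procs bag j ⊆ {out j} := by
  rcases hT.letter a with ⟨i, hi⟩ | ⟨c, -, hc⟩
  · by_cases hij : i = j
    · exact Or.inl fun p hp => mem_procs.2 ((hi p hp).trans hij)
    · refine Or.inr fun p hp => ?_
      rw [Finset.mem_inter, mem_procs] at hp
      exact absurd ((hi p hp.1).symm.trans hp.2) hij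
  · refine Or.inr fun p hp => ?_
    rw [Finset.mem_inter, mem_procs, hc, Finset.mem_insert, Finset.mem_singleton] at hp
    rw [Finset.mem_singleton]
    obtain ⟨rfl | rfl, h⟩ := hp <;> rw [← h, hT.bag_out]

theorem IsRooted.within_view_singleton (hT : IsRooted loc bag out root par dep) {p : P} {j : ι}
    (hp : p ∈ procs bag j) (w : List α) :
    within loc (procs bag j) (view loc {p} w) = view loc {p} (within loc (procs bag j) w) := by
  rw [within_view (hT.out_mem_procs j) (hT.subset_procs_or j)
    (Or.inl (Finset.singleton_subset_iff.2 hp)), Finset.singleton_inter_of_mem hp]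

theorem IsRooted.view_compl_subtree_eq (hT : IsRooted loc bag out root par dep) {j : ι}
    {C : Finset P} (hC : C ⊆ subtree bag par j) (ho : out j ∈ C) (w : List α) :
    view loc (subtree bag par j)ᶜ (view loc C w) = outside loc bag par w (out j) := by
  rw [outside, hT.bag_out]
  by_cases hj : j = root
  · rw [hj, subtree_root hT.dep_par, Finset.compl_univ, view_empty, view_empty]
  · have hX := mem_subtree_self (par := par) hT.bag_out j
    have hX' := out_parent_notMem_subtree hT.bag_out hT.par_root hT.dep_par hj
    rw [view_compl_view_eq hX hX' (subset_subtree_or hT.bag_out hT.letter j) hC ho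
      (Finset.disjoint_singleton_left.2 hX') (Finset.mem_singleton_self _),
      view_compl_view_eq hX hX' (subset_subtree_or hT.bag_out hT.letter j)
      (Finset.singleton_subset_iff.2 hX) (Finset.mem_singleton_self _)
      (Finset.disjoint_singleton_left.2 hX') (Finset.mem_singleton_self _)]

theorem IsRooted.run_view_eq_of_subset_procs (hT : IsRooted loc bag out root par dep)
    (hloc : ∀ a, (loc a).Nonempty) (hA : A.Diamond loc) (hk : 1 ≤ k)
    (hfair : ∀ j w, Feasible A w → Fair loc k (procs bag j) (within loc (procs bag j) w))
    {w w' : List α} {j : ι} {S : Finset P} (hS : S.Nonempty) (hSB : S ⊆ procs bag j)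
    (h : ∀ p ∈ S, SameState A loc k bag out par w w' p) :
    A.run A.init (view loc S w) = A.run A.init (view loc S w') := by
  refine run_view_eq_of_codeEq hloc hA hk (hT.out_mem_procs j) (hT.subset_procs_or j) hS hSB
    (fun p hp => ?_) (fun p hp => ?_) (fun p hp => ?_) _ fun p hp => (h p hp).run_eq
  · rw [← hT.within_view_singleton (hSB hp)]
    exact hfair j _ (h p hp).feasible
  · rw [← hT.within_view_singleton (hSB hp)]
    exact hfair j _ (h p hp).feasible'
  · have h1 := (h p hp).codeEq
    rwa [mem_procs.1 (hSB hp), hT.within_view_singleton (hSB hp),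
      hT.within_view_singleton (hSB hp)] at h1

theorem IsRooted.run_view_union_eq (hT : IsRooted loc bag out root par dep)
    (hloc : ∀ a, (loc a).Nonempty) (hA : A.Diamond loc) {w w' : List α} {c : ι} (hc : c ≠ root)
    {C W : Finset P} (hC : C ⊆ subtree bag par c) (hoC : out c ∈ C)
    (hW : Disjoint W (subtree bag par c)) (hoW : out (par c) ∈ W)
    (h : SameState A loc k bag out par w w' (out c))
    (hCrun : A.run A.init (view loc C w) = A.run A.init (view loc C w'))
    (hWrun : A.run A.init (view loc W w) = A.run A.init (view loc W w'))
    (hf : Feasible A (view loc (W ∪ C) w')) :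
    A.run A.init (view loc (W ∪ C) w) = A.run A.init (view loc (W ∪ C) w') := by
  obtain ⟨q, hq⟩ := hf.exists_run
  rw [hq]
  refine DistTrace.run_view_union_eq hloc hA (mem_subtree_self hT.bag_out c)
    (out_parent_notMem_subtree hT.bag_out hT.par_root hT.dep_par hc)
    (subset_subtree_or hT.bag_out hT.letter c) hC hoC hW hoW hCrun hWrun ?_ hq
  rw [hT.view_compl_subtree_eq hC hoC, hT.view_compl_subtree_eq hC hoC]
  exact h.run_outside_eq (by rw [hT.bag_out])

/-- The state after the common view of the processes of a letter is determined by their local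
states. -/
theorem IsRooted.run_view_loc_eq (hT : IsRooted loc bag out root par dep)
    (hloc : ∀ a, (loc a).Nonempty) (hA : A.Diamond loc) (hk : 1 ≤ k)
    (hfair : ∀ j w, Feasible A w → Fair loc k (procs bag j) (within loc (procs bag j) w))
    {w w' : List α} {a : α} (h : ∀ p ∈ loc a, SameState A loc k bag out par w w' p)
    (hf : Feasible A (view loc (loc a) w')) :
    A.run A.init (view loc (loc a) w) = A.run A.init (view loc (loc a) w') := by
  rcases hT.letter a with ⟨j, hj⟩ | ⟨c, hc, hca⟩
  · exact hT.run_view_eq_of_subset_procs hloc hA hk hfair (hloc a)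
      (fun p hp => mem_procs.2 (hj p hp)) h
  · have hX' := out_parent_notMem_subtree hT.bag_out hT.par_root hT.dep_par hc
    have hca' : loc a = {out (par c)} ∪ {out c} := by rw [hca, Finset.union_comm]; rfl
    rw [hca'] at hf ⊢
    have h1 : SameState A loc k bag out par w w' (out c) := h _ (by simp [hca])
    have h2 : SameState A loc k bag out par w w' (out (par c)) := h _ (by simp [hca])
    exact hT.run_view_union_eq hloc hA hc
      (Finset.singleton_subset_iff.2 (mem_subtree_self hT.bag_out c)) (Finset.mem_singleton_self _)
      (Finset.disjoint_singleton_left.2 hX') (Finset.mem_singleton_self _) h1 h1.run_eq h2.run_eq hf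

theorem IsRooted.within_view_loc_concat (hT : IsRooted loc bag out root par dep) {a : α} {p : P}
    (hp : p ∈ loc a) (ha : ¬ loc a ⊆ procs bag (bag p)) (w : List α) :
    within loc (procs bag (bag p)) (view loc (loc a) w ++ [a]) =
      within loc (procs bag (bag p)) (view loc {p} w) := by
  have hpB : p ∈ procs bag (bag p) := mem_procs.2 rfl
  have h1 := (hT.subset_procs_or (bag p) a).resolve_left ha
  have hpo := Finset.mem_singleton.1 (h1 (Finset.mem_inter.2 ⟨hp, hpB⟩))
  have h2 : loc a ∩ procs bag (bag p) = {p} := by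
    refine Finset.Subset.antisymm ?_ (Finset.singleton_subset_iff.2 (Finset.mem_inter.2 ⟨hp, hpB⟩))
    rwa [← hpo] at h1
  rw [within_append, within_singleton_of_not_subset ha, List.append_nil,
    within_view (hT.out_mem_procs _) (hT.subset_procs_or _) (Or.inr (hpo ▸ hp)), h2,
    hT.within_view_singleton hpB]

/-- Executing a letter preserves equality of the local states of its processes. -/
theorem IsRooted.sameState_concat (hT : IsRooted loc bag out root par dep)
    (hloc : ∀ a, (loc a).Nonempty) (hA : A.Diamond loc) (hk : 1 ≤ k)
    (hfair : ∀ j w, Feasible A w → Fair loc k (procs bag j) (within loc (procs bag j) w))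
    {w w' : List α} {a : α} (h : ∀ p ∈ loc a, SameState A loc k bag out par w w' p)
    (hf' : Feasible A (view loc (loc a) w' ++ [a])) {p : P} (hp : p ∈ loc a) :
    SameState A loc k bag out par (w ++ [a]) (w' ++ [a]) p := by
  have hrun := hT.run_view_loc_eq hloc hA hk hfair h (hf'.of_eqv_append hloc hA (Eqv.refl _))
  have hrun' : A.run A.init (view loc (loc a) w ++ [a]) =
      A.run A.init (view loc (loc a) w' ++ [a]) := by rw [run_append, run_append, hrun]
  refine ⟨?_, ?_, ?_, fun hpo => ?_, ?_⟩
  · rw [view_singleton_concat_of_mem hp]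
    exact hf'.of_run_eq hrun
  · rwa [view_singleton_concat_of_mem hp]
  · rwa [view_singleton_concat_of_mem hp, view_singleton_concat_of_mem hp]
  · rw [outside, outside, view_singleton_concat_of_mem hp, view_singleton_concat_of_mem hp]
    by_cases ha : loc a ⊆ subtree bag par (bag p)
    · have hd : Disjoint (loc a) (subtree bag par (bag p))ᶜ := disjoint_compl_right_iff.2 ha
      have hpa : out (bag p) ∈ loc a := hpo ▸ hp
      rw [view_concat_of_disjoint hd, view_concat_of_disjoint hd, hT.view_compl_subtree_eq ha hpa,
        hT.view_compl_subtree_eq ha hpa, ← hpo]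
      exact (h p hp).run_outside_eq hpo
    · have hd : ¬ Disjoint (loc a) (subtree bag par (bag p))ᶜ :=
        fun hd => ha (disjoint_compl_right_iff.1 hd)
      rwa [view_concat_of_not_disjoint hd, view_concat_of_not_disjoint hd,
        view_view_of_superset Finset.subset_union_right,
        view_view_of_superset Finset.subset_union_right]
  · rw [view_singleton_concat_of_mem hp, view_singleton_concat_of_mem hp]
    by_cases ha : loc a ⊆ procs bag (bag p)
    · have hin : ∀ v : List α, ∀ b ∈ within loc (procs bag (bag p)) v, loc b ⊆ procs bag (bag p) :=
        fun v b hb => (mem_within.1 hb).2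
      have hw : ∀ v : List α, within loc (procs bag (bag p)) (view loc (loc a) v ++ [a]) =
          view loc (loc a) (within loc (procs bag (bag p)) v) ++ [a] := fun v => by
        rw [within_append, within_singleton_of_subset ha,
          within_view (hT.out_mem_procs _) (hT.subset_procs_or _) (Or.inl ha),
          Finset.inter_eq_left.2 ha]
      rw [hw, hw]
      refine codeEq_view_concat hloc hk ha (hin w) (hin w') (fun r hr => ?_) (fun r hr => ?_)
        fun r hr => ?_
      · rw [← hT.within_view_singleton (ha hr)]
        exact hfair _ _ (h r hr).feasible
      · rw [← hT.within_view_singleton (ha hr)]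
        exact hfair _ _ (h r hr).feasible'
      · have h1 := (h r hr).codeEq
        rwa [mem_procs.1 (ha hr), hT.within_view_singleton (ha hr),
          hT.within_view_singleton (ha hr)] at h1
    · rw [hT.within_view_loc_concat hp ha, hT.within_view_loc_concat hp ha]
      exact (h p hp).codeEq

theorem IsRooted.localState_concat (hT : IsRooted loc bag out root par dep)
    (hloc : ∀ a, (loc a).Nonempty) (hA : A.Diamond loc) (hk : 1 ≤ k)
    (hfair : ∀ j w, Feasible A w → Fair loc k (procs bag j) (within loc (procs bag j) w))
    {w w' : List α} {a : α}
    (h : ∀ p ∈ loc a, localState A loc hk bag out par w p = localState A loc hk bag out par w' p)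
    {p : P} (hp : p ∈ loc a) :
    localState A loc hk bag out par (w ++ [a]) p =
      localState A loc hk bag out par (w' ++ [a]) p := by
  have key : ∀ v v' : List α, (∀ p ∈ loc a, localState A loc hk bag out par v p =
      localState A loc hk bag out par v' p) → Feasible A (view loc (loc a) v' ++ [a]) →
      localState A loc hk bag out par (v ++ [a]) p =
        localState A loc hk bag out par (v' ++ [a]) p := fun v v' hv hf =>
    (hT.sameState_concat hloc hA hk hfair (fun q hq => sameState_of_localState_eq hk hloc hA
      ((hf.of_eqv_append hloc hA (Eqv.refl _)).view_of_subset hloc hA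
        (Finset.singleton_subset_iff.2 hq)) (hv q hq)) hf hp).localState_eq hk hloc
  by_cases hf' : Feasible A (view loc (loc a) w' ++ [a])
  · exact key w w' h hf'
  by_cases hf : Feasible A (view loc (loc a) w ++ [a])
  · exact (key w' w (fun q hq => (h q hq).symm) hf).symm
  · rw [localState, localState, view_singleton_concat_of_mem hp, view_singleton_concat_of_mem hp,
      if_neg hf, if_neg hf']

theorem localState_concat_of_notMem (hk : 1 ≤ k) {a : α} {p : P} (hp : p ∉ loc a) (w : List α) :
    localState A loc hk bag out par (w ++ [a]) p = localState A loc hk bag out par w p := by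
  unfold localState outside
  rw [view_singleton_concat_of_notMem hp]

theorem IsRooted.run_eq [Fintype ι] (hT : IsRooted loc bag out root par dep)
    (hloc : ∀ a, (loc a).Nonempty) (hA : A.Diamond loc) (hk : 1 ≤ k)
    (hfair : ∀ j w, Feasible A w → Fair loc k (procs bag j) (within loc (procs bag j) w))
    {w w' : List α} (h : ∀ p, SameState A loc k bag out par w w' p) (hf : Feasible A w') :
    A.run A.init w = A.run A.init w' := by
  have key : ∀ s : Finset ι, (∀ c ∈ s, c ≠ root → par c ∈ s) →
      A.run A.init (view loc (Finset.univ.filter fun p => bag p ∈ s) w) =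
        A.run A.init (view loc (Finset.univ.filter fun p => bag p ∈ s) w') := by
    intro s
    induction s using Finset.induction_on_max_value dep with
    | empty => simp [view_empty]
    | insert c s hcs hmax ih =>
      intro hs
      have hset : (Finset.univ.filter fun p => bag p ∈ insert c s) =
          (Finset.univ.filter fun p => bag p ∈ s) ∪ procs bag c := by
        ext p
        simp [mem_procs, or_comm]
      have hC := hT.run_view_eq_of_subset_procs hloc hA hk hfair (w := w) (w' := w')
        ⟨_, hT.out_mem_procs c⟩ subset_rfl fun p _ => h p
      rw [hset]
      by_cases hc : c = root
      · have hs0 : (Finset.univ.filter fun p => bag p ∈ s) = ∅ := by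
          refine Finset.filter_eq_empty_iff.2 fun p _ hp => hcs ?_
          have h1 := eq_of_mem_subtree hT.par_root hT.dep_par
            (show p ∈ subtree bag par c by rw [hc, subtree_root hT.dep_par]; simp) (hmax _ hp)
          rwa [h1] at hp
        rw [hs0, Finset.empty_union]
        exact hC
      · have hpar : par c ∈ s := by
          refine (Finset.mem_insert.1 (hs c (Finset.mem_insert_self _ _) hc)).resolve_left
            fun h1 => ?_
          have h2 := hT.dep_par c hc
          rw [h1] at h2
          exact lt_irrefl _ h2
        refine hT.run_view_union_eq hloc hA hc (procs_subset_subtree c) (hT.out_mem_procs c)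
          (Finset.disjoint_left.2 fun p hp hpc => hcs ?_) (by simpa [hT.bag_out]) (h _) hC
          (ih fun d hd hdr => ?_) (hf.view hloc hA _)
        · have h1 := (Finset.mem_filter.1 hp).2
          rwa [eq_of_mem_subtree hT.par_root hT.dep_par hpc (hmax _ h1)] at h1
        · refine (Finset.mem_insert.1 (hs d (Finset.mem_insert_of_mem hd) hdr)).resolve_left
            fun h1 => ?_
          have h2 := hT.dep_par d hdr
          rw [h1] at h2
          exact absurd (hmax d hd) (by omega)
  simpa [view_univ hloc] using key Finset.univ (by simp)

theorem IsRooted.mem_lang_of_localState_eq [Fintype ι] (hT : IsRooted loc bag out root par dep)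
    (hloc : ∀ a, (loc a).Nonempty) (hA : A.Diamond loc) (hk : 1 ≤ k)
    (hfair : ∀ j w, Feasible A w → Fair loc k (procs bag j) (within loc (procs bag j) w))
    {w w' : List α}
    (h : localState A loc hk bag out par w = localState A loc hk bag out par w')
    (hw : w ∈ A.lang) : w' ∈ A.lang := by
  have hf : Feasible A w := ⟨[], by rwa [List.append_nil]⟩
  have hrun := hT.run_eq hloc hA hk hfair (fun p => sameState_of_localState_eq hk hloc hA
    (hf.view hloc hA _) (congrFun h.symm p)) hf
  obtain ⟨q, hq, hqw⟩ := hw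
  exact ⟨q, hq, hrun.trans hqw⟩

end Tree

section Fairness

variable [DecidableEq P] [Fintype P] {ι Q : Type*} [DecidableEq ι] {A : DetAut α Q}
  {loc : α → Finset P} {k : ℕ} {bag : P → ι}

theorem fair_within_of_feasible (hloc : ∀ a, (loc a).Nonempty) {j : ι}
    (hfair : ∀ w ∈ A.lang, ∀ w' u v x : List α,
      TraceEquiv loc (w.filter fun a => decide (∀ p ∈ loc a, bag p = j)) w' →
      w' = u ++ v ++ x → k ≤ v.length → ∀ p : P, bag p = j → p ∈ locWord loc v)
    {w : List α} (hw : Feasible A w) :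
    Fair loc k (procs bag j) (within loc (procs bag j) w) := by
  intro x y hxy r hr hy
  by_contra hlt
  obtain ⟨v, hv⟩ := hw
  have hwithin : ∀ u : List α, u.filter (fun a => decide (∀ p ∈ loc a, bag p = j)) =
      within loc (procs bag j) u := fun u => by simp only [within, Finset.subset_iff, mem_procs]
  have h1 : Eqv loc ((w ++ v).filter fun a => decide (∀ p ∈ loc a, bag p = j))
      (x ++ y ++ within loc (procs bag j) v) := by
    rw [hwithin, within_append]
    exact hxy.append (Eqv.refl _)
  obtain ⟨a, ha, hra⟩ := mem_locWord.1 (hfair _ hv _ x y _ (traceEquiv_of_eqv hloc h1) rfl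
    (not_lt.1 hlt) r (mem_procs.1 hr))
  exact hy a ha hra

end Fairness

section Bounds

variable [DecidableEq P] [Fintype P] {ι Q : Type*} [DecidableEq ι]
  {A : DetAut α Q} {loc : α → Finset P} {k : ℕ} {bag : P → ι} {out : ι → P} {par : ι → ι}

theorem card_range_localState_of_isEmpty [IsEmpty α] (hk : 1 ≤ k) (p : P) :
    Nat.card (Set.range fun w => localState A loc hk bag out par w p) ≤ 1 := by
  have : Subsingleton (Set.range fun w => localState A loc hk bag out par w p) := by
    refine ⟨?_⟩
    rintro ⟨_, w, rfl⟩ ⟨_, w', rfl⟩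
    exact Subtype.ext (congrArg (localState A loc hk bag out par · p) (Subsingleton.elim w w'))
  exact Finite.card_le_one_iff_subsingleton.2 this

variable [Fintype α]

theorem card_option_option_pow_le [Nonempty α] :
    Fintype.card (Fin (3 * k) → Option (Option α)) ≤ (2 * Fintype.card α + 1) ^ (3 * k) := by
  rw [Fintype.card_fun, Fintype.card_option, Fintype.card_option, Fintype.card_fin]
  have := Fintype.card_pos (α := α)
  exact Nat.pow_le_pow_left (by omega) _

variable [Fintype Q]

theorem card_range_localState_le (hk : 1 ≤ k) (p : P) :
    Nat.card (Set.range fun w => localState A loc hk bag out par w p) ≤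
      2 * k * Fintype.card Q ^ 3 * (2 * Fintype.card α + 1) ^ (3 * k) := by
  have hQ : 0 < Fintype.card Q := Fintype.card_pos_iff.2 ⟨A.init⟩
  rcases isEmpty_or_nonempty α with _ | _
  · exact (card_range_localState_of_isEmpty hk p).trans (Nat.succ_le_of_lt (by positivity))
  · refine (Nat.card_le_card_of_injective _ Subtype.val_injective).trans ?_
    rw [Nat.card_eq_fintype_card, Fintype.card_prod, Fintype.card_prod, Fintype.card_prod,
      Fintype.card_fin]
    calc 2 * k * (Fintype.card Q * (Fintype.card Q *
            Fintype.card (Fin (3 * k) → Option (Option α))))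
        = 2 * k * Fintype.card Q ^ 2 * Fintype.card (Fin (3 * k) → Option (Option α)) := by ring
      _ ≤ _ := Nat.mul_le_mul (Nat.mul_le_mul_left _ (Nat.pow_le_pow_right hQ (by norm_num)))
          card_option_option_pow_le

theorem card_range_localState_inner_le (hk : 1 ≤ k) {p : P} (hp : p ≠ out (bag p)) :
    Nat.card (Set.range fun w => localState A loc hk bag out par w p) ≤
      2 * k * Fintype.card Q * (2 * Fintype.card α + 1) ^ (3 * k) := by
  have hQ : 0 < Fintype.card Q := Fintype.card_pos_iff.2 ⟨A.init⟩
  rcases isEmpty_or_nonempty α with _ | _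
  · exact (card_range_localState_of_isEmpty hk p).trans (Nat.succ_le_of_lt (by positivity))
  · have hinit : ∀ w, (localState A loc hk bag out par w p).2.2.1 = A.init := fun w => by
      rw [localState, if_neg hp]
      split_ifs <;> rfl
    refine (Nat.card_le_card_of_injective (β := Fin (2 * k) × Q × (Fin (3 * k) → Option (Option α)))
      (fun x => (x.1.1, x.1.2.1, x.1.2.2.2)) ?_).trans ?_
    · rintro ⟨_, w, rfl⟩ ⟨_, w', rfl⟩ h
      simp only [Prod.mk.injEq] at h
      refine Subtype.ext (Prod.ext h.1 (Prod.ext h.2.1 (Prod.ext ?_ h.2.2)))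
      exact (hinit w).trans (hinit w').symm
    · rw [Nat.card_eq_fintype_card, Fintype.card_prod, Fintype.card_prod, Fintype.card_fin,
        ← mul_assoc]
      exact Nat.mul_le_mul_left _ card_option_option_pow_le

end Bounds

end DistTrace

/-- (Combining fairness with acyclic communication.)
Tree-of-bags architecture: processes are partitioned into bags (`bag : P → ι`),
each bag `j` has an outer process `out j`, the communication graph on the outer
processes is a tree, and inner processes communicate only within their bag.
If a DFA `A` with the diamond property is such that, for every bag `j`, the
restriction to the bag alphabet of every trace of `A` is `k`-fair for the
processes of the bag, then there is a trace-equivalent finite asynchronous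
automaton whose outer (resp. inner) processes have at most
`2k·n³·(2|Σ|+1)^(3k)` (resp. `2k·n·(2|Σ|+1)^(3k)`) local states. -/
theorem exists_finite_asyncAut_tree_of_bags {QA ι : Type*} [DecidableEq P]
    [DecidableEq ι] [Fintype α] [Fintype P] [Fintype QA] [Fintype ι]
    (loc : α → Finset P) (hloc : ∀ a, (loc a).Nonempty)
    (bag : P → ι) (out : ι → P) (hout : ∀ j, bag (out j) = j)
    (hinner : ∀ (a : α) (p : P), p ∈ loc a → p ≠ out (bag p) →
      ∀ q ∈ loc a, bag q = bag p)
    (htree : (commGraphOuter loc out).IsTree)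
    (k : ℕ) (hk : 1 ≤ k)
    (A : DetAut α QA) (hdiam : A.Diamond loc)
    (hfair : ∀ (j : ι), ∀ w ∈ A.lang, ∀ w' u v x : List α,
      TraceEquiv loc (w.filter fun a => decide (∀ p ∈ loc a, bag p = j)) w' →
      w' = u ++ v ++ x → k ≤ v.length →
      ∀ p : P, bag p = j → p ∈ locWord loc v) :
    ∃ (Q : P → Type) (inst : ∀ p, Fintype (Q p)) (B : AsyncAut α loc Q),
      traceClosure loc B.lang = traceClosure loc A.lang ∧
      (∀ p : P, p = out (bag p) → @Fintype.card (Q p) (inst p) ≤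
        2 * k * (Fintype.card QA) ^ 3 * (2 * Fintype.card α + 1) ^ (3 * k)) ∧
      (∀ p : P, p ≠ out (bag p) → @Fintype.card (Q p) (inst p) ≤
        2 * k * Fintype.card QA * (2 * Fintype.card α + 1) ^ (3 * k)) := by
  obtain ⟨root, par, dep, hroot, hdep, hletter⟩ := DistTrace.exists_parent hinner htree
  have hT : DistTrace.IsRooted loc bag out root par dep := ⟨hout, hroot, hdep, hletter⟩
  have hfair' := fun j w (hw : DistTrace.Feasible A w) =>
    DistTrace.fair_within_of_feasible hloc (hfair j) hw
  obtain ⟨Q, inst, B, hB, hcard⟩ := DistTrace.exists_asyncAut_of_localState (L := A.lang)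
    (DistTrace.localState A loc hk bag out par)
    (fun w _ _ hp => DistTrace.localState_concat_of_notMem hk hp w)
    (fun _ _ _ h _ hp => hT.localState_concat hloc hdiam hk hfair' h hp)
    fun _ _ h hw => hT.mem_lang_of_localState_eq hloc hdiam hk hfair' h hw
  refine ⟨Q, inst, B, by rw [hB], fun p _ => ?_, fun p hp => ?_⟩
  · rw [hcard]
    exact DistTrace.card_range_localState_le hk p
  · rw [hcard]
    exact DistTrace.card_range_localState_inner_le hk hp
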